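/- arXiv:2209.08354 — 5 statements merged into one kernel-verified Lean document; each statement's English description precedes it below -/
import Mathlib

section
/- Let q = 2^h be a power of 2 and F a finite field with q elements. Consider the action of GL(3,F) on the set of 3-dimensional F-linear subspaces of Sym₃(F) given by A·W = {A M Aᵀ : M ∈ W}. Then the number of orbits of 3-dimensional subspaces W that contain at least one matrix of rank 1 is exactly 15. -/
open Matrix

/-- A *plane with at least one rank-1 point*: a 3-dimensional linear subspace of the space of
symmetric `3×3` matrices over `F` containing a matrix of rank `1`. -/
def IsRankOnePlane (F : Type) [Field F] (W : Submodule F (Matrix (Fin 3) (Fin 3) F)) : Prop :=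
  Module.finrank F ↥W = 3 ∧ (∀ M ∈ W, M.IsSymm) ∧ ∃ M ∈ W, M.rank = 1

/-- Two subspaces of `Sym₃(F)` are equivalent if some `A ∈ GL(3,F)` maps one onto the other
via the congruence action `M ↦ A M Aᵀ`. -/
def CongruenceEquiv (F : Type) [Field F] (W W' : Submodule F (Matrix (Fin 3) (Fin 3) F)) : Prop :=
  ∃ A : GL (Fin 3) F,
    (fun M => (A : Matrix (Fin 3) (Fin 3) F) * M * (A : Matrix (Fin 3) (Fin 3) F)ᵀ) ''
      (W : Set (Matrix (Fin 3) (Fin 3) F)) = (W' : Set (Matrix (Fin 3) (Fin 3) F))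

namespace VeronesePlanes

open Module

/-! ### Symmetric matrices and planes through a fixed rank-one point -/

/-- The symmetric matrix with diagonal `X, Y, Z` and entries `p, q, r` at the positions
`(2,3)`, `(1,3)`, `(1,2)`. -/
def symMat {F : Type} (X Y Z p q r : F) : Matrix (Fin 3) (Fin 3) F := !![X, r, q; r, Y, p; q, p, Z]

theorem symMat_inj {F : Type} {X Y Z p q r X' Y' Z' p' q' r' : F} :
    symMat X Y Z p q r = symMat X' Y' Z' p' q' r' ↔
      X = X' ∧ Y = Y' ∧ Z = Z' ∧ p = p' ∧ q = q' ∧ r = r' := by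
  constructor
  · intro h
    have h1 := congrFun (congrFun h 0) 0
    have h2 := congrFun (congrFun h 1) 1
    have h3 := congrFun (congrFun h 2) 2
    have h4 := congrFun (congrFun h 1) 2
    have h5 := congrFun (congrFun h 0) 2
    have h6 := congrFun (congrFun h 0) 1
    simp [symMat] at h1 h2 h3 h4 h5 h6
    exact ⟨h1, h2, h3, h4, h5, h6⟩
  · rintro ⟨rfl, rfl, rfl, rfl, rfl, rfl⟩
    rfl

theorem symMat_isSymm {F : Type} (X Y Z p q r : F) : (symMat X Y Z p q r).IsSymm := by
  ext i j; fin_cases i <;> fin_cases j <;> simp [symMat]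

theorem exists_eq_symMat {F : Type} {M : Matrix (Fin 3) (Fin 3) F} (h : M.IsSymm) :
    ∃ X Y Z p q r, M = symMat X Y Z p q r := by
  refine ⟨M 0 0, M 1 1, M 2 2, M 1 2, M 0 2, M 0 1, ?_⟩
  ext i j; fin_cases i <;> fin_cases j <;> simp [symMat, h.apply 0 1, h.apply 0 2, h.apply 1 2]

section Basic

variable {F : Type} [Field F]

/-- The span of `E₁₁` and two symmetric matrices whose `(1,1)` entries vanish. -/
def plane (Y₁ Z₁ p₁ q₁ r₁ Y₂ Z₂ p₂ q₂ r₂ : F) : Submodule F (Matrix (Fin 3) (Fin 3) F) :=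
  Submodule.span F {symMat 1 0 0 0 0 0, symMat 0 Y₁ Z₁ p₁ q₁ r₁, symMat 0 Y₂ Z₂ p₂ q₂ r₂}

/-- The plane of symmetric matrices with diagonal `X, Y, Z` and entries `a Y + b Z`, `c Y + d Z`,
`e Y + f Z` at the positions `(2,3)`, `(1,3)`, `(1,2)`. -/
def diagPlane (a b c e d f : F) : Submodule F (Matrix (Fin 3) (Fin 3) F) :=
  plane 1 0 a c e 0 1 b d f

theorem symMat_add (X Y Z p q r X' Y' Z' p' q' r' : F) :
    symMat X Y Z p q r + symMat X' Y' Z' p' q' r' =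
      symMat (X + X') (Y + Y') (Z + Z') (p + p') (q + q') (r + r') := by
  ext i j; fin_cases i <;> fin_cases j <;> simp [symMat]

theorem smul_symMat (x X Y Z p q r : F) :
    x • symMat X Y Z p q r = symMat (x * X) (x * Y) (x * Z) (x * p) (x * q) (x * r) := by
  ext i j; fin_cases i <;> fin_cases j <;> simp [symMat]

theorem symMat_eq_zero {X Y Z p q r : F} :
    symMat X Y Z p q r = 0 ↔ X = 0 ∧ Y = 0 ∧ Z = 0 ∧ p = 0 ∧ q = 0 ∧ r = 0 := by
  have : (0 : Matrix (Fin 3) (Fin 3) F) = symMat 0 0 0 0 0 0 := by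
    ext i j; fin_cases i <;> fin_cases j <;> simp [symMat]
  rw [this, symMat_inj]

theorem mem_plane {Y₁ Z₁ p₁ q₁ r₁ Y₂ Z₂ p₂ q₂ r₂ : F} {M : Matrix (Fin 3) (Fin 3) F} :
    M ∈ plane Y₁ Z₁ p₁ q₁ r₁ Y₂ Z₂ p₂ q₂ r₂ ↔
      ∃ x y z, M = symMat x (y * Y₁ + z * Y₂) (y * Z₁ + z * Z₂) (y * p₁ + z * p₂)
        (y * q₁ + z * q₂) (y * r₁ + z * r₂) := by
  simp only [plane, Submodule.mem_span_triple, smul_symMat, symMat_add]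
  constructor
  · rintro ⟨x, y, z, rfl⟩
    exact ⟨x, y, z, by simp⟩
  · rintro ⟨x, y, z, rfl⟩
    exact ⟨x, y, z, by simp⟩

theorem symMat_mem_plane {Y₁ Z₁ p₁ q₁ r₁ Y₂ Z₂ p₂ q₂ r₂ X Y Z p q r : F} :
    symMat X Y Z p q r ∈ plane Y₁ Z₁ p₁ q₁ r₁ Y₂ Z₂ p₂ q₂ r₂ ↔
      ∃ y z, Y = y * Y₁ + z * Y₂ ∧ Z = y * Z₁ + z * Z₂ ∧ p = y * p₁ + z * p₂ ∧
        q = y * q₁ + z * q₂ ∧ r = y * r₁ + z * r₂ := by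
  simp only [mem_plane, symMat_inj]
  constructor
  · rintro ⟨x, y, z, -, h⟩
    exact ⟨y, z, h⟩
  · rintro ⟨y, z, h⟩
    exact ⟨X, y, z, rfl, h⟩

theorem isSymm_of_mem_plane {Y₁ Z₁ p₁ q₁ r₁ Y₂ Z₂ p₂ q₂ r₂ : F} {M : Matrix (Fin 3) (Fin 3) F}
    (h : M ∈ plane Y₁ Z₁ p₁ q₁ r₁ Y₂ Z₂ p₂ q₂ r₂) : M.IsSymm := by
  obtain ⟨x, y, z, rfl⟩ := mem_plane.1 h
  exact symMat_isSymm ..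

theorem symMat_one_mem_plane {Y₁ Z₁ p₁ q₁ r₁ Y₂ Z₂ p₂ q₂ r₂ : F} :
    symMat 1 0 0 0 0 0 ∈ plane Y₁ Z₁ p₁ q₁ r₁ Y₂ Z₂ p₂ q₂ r₂ :=
  symMat_mem_plane.2 ⟨0, 0, by simp⟩

theorem rank_symMat_one : (symMat 1 0 0 0 0 0 : Matrix (Fin 3) (Fin 3) F).rank = 1 := by
  have : (symMat 1 0 0 0 0 0 : Matrix (Fin 3) (Fin 3) F) = diagonal ![1, 0, 0] := by
    ext i j; fin_cases i <;> fin_cases j <;> simp [symMat]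
  classical
  rw [this, rank_diagonal, Fintype.card_eq_one_iff]
  refine ⟨⟨0, by simp⟩, ?_⟩
  rintro ⟨i, hi⟩
  fin_cases i
  · rfl
  all_goals exact absurd rfl hi

theorem finrank_plane_le (Y₁ Z₁ p₁ q₁ r₁ Y₂ Z₂ p₂ q₂ r₂ : F) :
    finrank F (plane Y₁ Z₁ p₁ q₁ r₁ Y₂ Z₂ p₂ q₂ r₂) ≤ 3 := by
  classical
  have h := finrank_span_finset_le_card (R := F)
    ({symMat 1 0 0 0 0 0, symMat 0 Y₁ Z₁ p₁ q₁ r₁, symMat 0 Y₂ Z₂ p₂ q₂ r₂} :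
      Finset (Matrix (Fin 3) (Fin 3) F))
  have h' := Finset.card_le_three (a := symMat 1 0 0 0 0 0) (b := symMat 0 Y₁ Z₁ p₁ q₁ r₁)
    (c := symMat 0 Y₂ Z₂ p₂ q₂ r₂)
  rw [Finset.coe_insert, Finset.coe_insert, Finset.coe_singleton] at h
  exact h.trans h'

theorem finrank_plane_eq_three_iff {Y₁ Z₁ p₁ q₁ r₁ Y₂ Z₂ p₂ q₂ r₂ : F} :
    finrank F (plane Y₁ Z₁ p₁ q₁ r₁ Y₂ Z₂ p₂ q₂ r₂) = 3 ↔
    ∀ y z, y * Y₁ + z * Y₂ = 0 → y * Z₁ + z * Z₂ = 0 → y * p₁ + z * p₂ = 0 →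
      y * q₁ + z * q₂ = 0 → y * r₁ + z * r₂ = 0 → y = 0 ∧ z = 0 := by
  have hr : plane Y₁ Z₁ p₁ q₁ r₁ Y₂ Z₂ p₂ q₂ r₂ = Submodule.span F (Set.range
      ![symMat 1 0 0 0 0 0, symMat 0 Y₁ Z₁ p₁ q₁ r₁, symMat 0 Y₂ Z₂ p₂ q₂ r₂]) := by
    rw [plane]; congr 1
    ext M; simp [or_comm, or_assoc, or_left_comm]
  have hli := linearIndependent_iff_card_eq_finrank_span (R := F)
    (b := ![symMat 1 0 0 0 0 0, symMat 0 Y₁ Z₁ p₁ q₁ r₁, symMat 0 Y₂ Z₂ p₂ q₂ r₂])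
  rw [Fintype.card_fin, Set.finrank, ← hr, eq_comm] at hli
  rw [← hli, Fintype.linearIndependent_iff]
  simp only [Fin.sum_univ_three, cons_val_zero, cons_val_one, cons_val, smul_symMat, symMat_add,
    symMat_eq_zero, Fin.forall_fin_succ, Fin.forall_fin_zero]
  constructor
  · intro h y z h1 h2 h3 h4 h5
    have := h ![0, y, z] (by simp [*])
    simpa using this
  · intro h g
    rintro ⟨h0, h1, h2, h3, h4, h5⟩
    have := h (g 1) (g 2) (by simpa using h1) (by simpa using h2) (by simpa using h3)
      (by simpa using h4) (by simpa using h5)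
    simp at h0
    exact ⟨h0, this.1, this.2, trivial⟩

theorem isRankOnePlane_plane {Y₁ Z₁ p₁ q₁ r₁ Y₂ Z₂ p₂ q₂ r₂ : F}
    (h : ∀ y z, y * Y₁ + z * Y₂ = 0 → y * Z₁ + z * Z₂ = 0 → y * p₁ + z * p₂ = 0 →
      y * q₁ + z * q₂ = 0 → y * r₁ + z * r₂ = 0 → y = 0 ∧ z = 0) :
    IsRankOnePlane F (plane Y₁ Z₁ p₁ q₁ r₁ Y₂ Z₂ p₂ q₂ r₂) :=
  ⟨finrank_plane_eq_three_iff.2 h, fun _ => isSymm_of_mem_plane,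
    _, symMat_one_mem_plane, rank_symMat_one⟩

end Basic

/-! ### Congruence of subspaces -/

section Congruence

variable {F : Type} [Field F]

theorem congruenceEquiv_refl (W : Submodule F (Matrix (Fin 3) (Fin 3) F)) :
    CongruenceEquiv F W W := ⟨1, by simp⟩

theorem congruenceEquiv_symm {W W' : Submodule F (Matrix (Fin 3) (Fin 3) F)}
    (h : CongruenceEquiv F W W') : CongruenceEquiv F W' W := by
  obtain ⟨A, hA⟩ := h
  refine ⟨A⁻¹, ?_⟩
  rw [← hA, Set.image_image]
  convert Set.image_id _ using 2
  ext1 M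
  have h1 : (A⁻¹ : GL (Fin 3) F).val * A.val = 1 := A.inv_mul
  have h2 : A.valᵀ * (A⁻¹ : GL (Fin 3) F).valᵀ = 1 := by
    rw [← transpose_mul, h1, transpose_one]
  calc _ = ((A⁻¹ : GL (Fin 3) F).val * A.val) * M * (A.valᵀ * (A⁻¹ : GL (Fin 3) F).valᵀ) := by
        simp only [Matrix.mul_assoc]
    _ = id M := by rw [h1, h2]; simp

theorem congruenceEquiv_trans {W W' W'' : Submodule F (Matrix (Fin 3) (Fin 3) F)}
    (h : CongruenceEquiv F W W') (h' : CongruenceEquiv F W' W'') : CongruenceEquiv F W W'' := by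
  obtain ⟨A, hA⟩ := h
  obtain ⟨B, hB⟩ := h'
  refine ⟨B * A, ?_⟩
  rw [← hB, ← hA, Set.image_image]
  simp only [Units.val_mul, transpose_mul, Matrix.mul_assoc]

theorem mem_of_congruence {W W' : Submodule F (Matrix (Fin 3) (Fin 3) F)} {A : GL (Fin 3) F}
    (hA : (fun M => (A : Matrix (Fin 3) (Fin 3) F) * M * (A : Matrix (Fin 3) (Fin 3) F)ᵀ) ''
      (W : Set (Matrix (Fin 3) (Fin 3) F)) = (W' : Set (Matrix (Fin 3) (Fin 3) F)))
    {M : Matrix (Fin 3) (Fin 3) F} (hM : M ∈ W) :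
    (A : Matrix (Fin 3) (Fin 3) F) * M * (A : Matrix (Fin 3) (Fin 3) F)ᵀ ∈ W' := by
  rw [← SetLike.mem_coe, ← hA]
  exact ⟨M, hM, rfl⟩

/-- The congruence action of an invertible matrix as a linear automorphism. -/
def congruenceLin (A : Matrix (Fin 3) (Fin 3) F) :
    Matrix (Fin 3) (Fin 3) F →ₗ[F] Matrix (Fin 3) (Fin 3) F where
  toFun M := A * M * Aᵀ
  map_add' M N := by rw [Matrix.mul_add, Matrix.add_mul]
  map_smul' c M := by simp

theorem congruenceLin_apply (A M : Matrix (Fin 3) (Fin 3) F) :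
    congruenceLin A M = A * M * Aᵀ := rfl

theorem congruence_injective {A : Matrix (Fin 3) (Fin 3) F} (hA : A.det ≠ 0) :
    Function.Injective (congruenceLin A) := by
  intro M N h
  have hu : IsUnit A := (isUnit_iff_isUnit_det A).2 (isUnit_iff_ne_zero.2 hA)
  have hu' : IsUnit Aᵀ := (isUnit_iff_isUnit_det _).2 (by
    rw [det_transpose]; exact isUnit_iff_ne_zero.2 hA)
  exact hu.mul_left_cancel (hu'.mul_right_cancel h)

theorem congruenceEquiv_of_forall_mem {W W' : Submodule F (Matrix (Fin 3) (Fin 3) F)}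
    {A : Matrix (Fin 3) (Fin 3) F} (hA : A.det ≠ 0) (hle : finrank F W' ≤ finrank F W)
    (h : ∀ M ∈ W, A * M * Aᵀ ∈ W') : CongruenceEquiv F W W' := by
  refine ⟨GeneralLinearGroup.mkOfDetNeZero A hA, ?_⟩
  have hmap : W.map (congruenceLin A) ≤ W' := by
    rintro _ ⟨M, hM, rfl⟩
    exact h M hM
  have heq : W.map (congruenceLin A) = W' := by
    apply Submodule.eq_of_le_of_finrank_le hmap
    rwa [← (Submodule.equivMapOfInjective _ (congruence_injective hA) W).finrank_eq]
  rw [← heq]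
  rfl

theorem finrank_eq_of_congruenceEquiv {W W' : Submodule F (Matrix (Fin 3) (Fin 3) F)}
    (h : CongruenceEquiv F W W') : finrank F W = finrank F W' := by
  obtain ⟨A, hA⟩ := h
  have hd : (A : Matrix (Fin 3) (Fin 3) F).det ≠ 0 :=
    ((isUnit_iff_isUnit_det _).1 A.isUnit).ne_zero
  have : W' = W.map (congruenceLin (A : Matrix (Fin 3) (Fin 3) F)) :=
    SetLike.coe_injective hA.symm
  rw [this]
  exact (Submodule.equivMapOfInjective _ (congruence_injective hd) W).finrank_eq

end Congruence

/-! ### Reduction to normal forms -/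

section NormalForms

variable {F : Type} [Field F] [CharP F 2]

theorem congruence_symMat (κ l m p q s t X Y Z P Q R : F) :
    !![κ, l, m; 0, p, q; 0, s, t] * symMat X Y Z P Q R * !![κ, l, m; 0, p, q; 0, s, t]ᵀ =
      symMat (κ ^ 2 * X + l ^ 2 * Y + m ^ 2 * Z) (p ^ 2 * Y + q ^ 2 * Z) (s ^ 2 * Y + t ^ 2 * Z)
        (p * s * Y + q * t * Z + (p * t + q * s) * P)
        (l * s * Y + m * t * Z + (l * t + m * s) * P + κ * t * Q + κ * s * R)
        (l * p * Y + m * q * Z + (l * q + m * p) * P + κ * q * Q + κ * p * R) := by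
  ext i j
  fin_cases i <;> fin_cases j <;> simp [symMat, Matrix.mul_apply, Fin.sum_univ_three] <;> grind

theorem plane_equiv (κ l m p q s t : F) {Y₁ Z₁ p₁ q₁ r₁ Y₂ Z₂ p₂ q₂ r₂ : F}
    {Y₁' Z₁' p₁' q₁' r₁' Y₂' Z₂' p₂' q₂' r₂' : F}
    (hW : finrank F (plane Y₁ Z₁ p₁ q₁ r₁ Y₂ Z₂ p₂ q₂ r₂) = 3)
    (hκ : κ ≠ 0) (hΔ : p * t + q * s ≠ 0)
    (h₁ : symMat 0 (p ^ 2 * Y₁ + q ^ 2 * Z₁) (s ^ 2 * Y₁ + t ^ 2 * Z₁)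
        (p * s * Y₁ + q * t * Z₁ + (p * t + q * s) * p₁)
        (l * s * Y₁ + m * t * Z₁ + (l * t + m * s) * p₁ + κ * t * q₁ + κ * s * r₁)
        (l * p * Y₁ + m * q * Z₁ + (l * q + m * p) * p₁ + κ * q * q₁ + κ * p * r₁) ∈
      plane Y₁' Z₁' p₁' q₁' r₁' Y₂' Z₂' p₂' q₂' r₂')
    (h₂ : symMat 0 (p ^ 2 * Y₂ + q ^ 2 * Z₂) (s ^ 2 * Y₂ + t ^ 2 * Z₂)
        (p * s * Y₂ + q * t * Z₂ + (p * t + q * s) * p₂)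
        (l * s * Y₂ + m * t * Z₂ + (l * t + m * s) * p₂ + κ * t * q₂ + κ * s * r₂)
        (l * p * Y₂ + m * q * Z₂ + (l * q + m * p) * p₂ + κ * q * q₂ + κ * p * r₂) ∈
      plane Y₁' Z₁' p₁' q₁' r₁' Y₂' Z₂' p₂' q₂' r₂') :
    CongruenceEquiv F (plane Y₁ Z₁ p₁ q₁ r₁ Y₂ Z₂ p₂ q₂ r₂)
      (plane Y₁' Z₁' p₁' q₁' r₁' Y₂' Z₂' p₂' q₂' r₂') := by
  refine congruenceEquiv_of_forall_mem (A := !![κ, l, m; 0, p, q; 0, s, t]) ?_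
    (le_of_le_of_eq (finrank_plane_le ..) hW.symm) ?_
  · have : (!![κ, l, m; 0, p, q; 0, s, t] : Matrix (Fin 3) (Fin 3) F).det =
        κ * (p * t + q * s) := by
      rw [det_fin_three]
      simp
      grind
    rw [this]
    exact mul_ne_zero hκ hΔ
  · intro M hM
    obtain ⟨x, y, z, rfl⟩ := mem_plane.1 hM
    rw [congruence_symMat]
    obtain ⟨y₁, z₁, a1, a2, a3, a4, a5⟩ := symMat_mem_plane.1 h₁
    obtain ⟨y₂, z₂, b1, b2, b3, b4, b5⟩ := symMat_mem_plane.1 h₂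
    refine symMat_mem_plane.2 ⟨y * y₁ + z * y₂, y * z₁ + z * z₂, ?_, ?_, ?_, ?_, ?_⟩
    · linear_combination y * a1 + z * b1
    · linear_combination y * a2 + z * b2
    · linear_combination y * a3 + z * b3
    · linear_combination y * a4 + z * b4
    · linear_combination y * a5 + z * b5

/-- The conditions for a block matrix to carry one plane `diagPlane` into another. -/
theorem diagPlane_equiv (κ l m p q s t : F) {a b c e d f a' b' c' e' d' f' : F}
    (hκ : κ ≠ 0) (hΔ : p * t + q * s ≠ 0)
    (h1 : p * s + (p * t + q * s) * a = a' * p ^ 2 + b' * s ^ 2)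
    (h2 : q * t + (p * t + q * s) * b = a' * q ^ 2 + b' * t ^ 2)
    (h3 : κ * (p * e + q * c) + l * (p + q * a) + m * p * a = e' * p ^ 2 + f' * s ^ 2)
    (h4 : κ * (p * f + q * d) + l * q * b + m * (p * b + q) = e' * q ^ 2 + f' * t ^ 2)
    (h5 : κ * (s * e + t * c) + l * (s + t * a) + m * s * a = c' * p ^ 2 + d' * s ^ 2)
    (h6 : κ * (s * f + t * d) + l * t * b + m * (s * b + t) = c' * q ^ 2 + d' * t ^ 2) :
    CongruenceEquiv F (diagPlane a b c e d f) (diagPlane a' b' c' e' d' f') := by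
  refine plane_equiv κ l m p q s t ?_ hκ hΔ (symMat_mem_plane.2 ⟨p ^ 2, s ^ 2, ?_⟩)
    (symMat_mem_plane.2 ⟨q ^ 2, t ^ 2, ?_⟩)
  · exact finrank_plane_eq_three_iff.2 fun y z h h' _ _ _ => by simpa using And.intro h h'
  · refine ⟨by ring, by ring, by linear_combination h1, by linear_combination h5,
      by linear_combination h3⟩
  · refine ⟨by ring, by ring, by linear_combination h2, by linear_combination h6,
      by linear_combination h4⟩

/-- A suitable change of basis makes the binary cubic `c y³ + e y² z + d y z² + f z³` apolar to the
binary quadratic form `a y² + y z + b z²`. -/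
theorem diagPlane_equiv_apolar (a b c e d f : F) :
    ∃ c' e' d' f', e' = a * d' + b * c' ∧ d' = a * f' + b * e' ∧
      CongruenceEquiv F (diagPlane a b c e d f) (diagPlane a b c' e' d' f') := by
  set l := a * d + e + b * c with hl
  set m := a * f + d + b * e with hm
  refine ⟨c + l * a, e + l + m * a, d + m + l * b, f + m * b, by grind, by grind,
    diagPlane_equiv 1 l m 1 0 0 1 one_ne_zero ?_ ?_ ?_ ?_ ?_ ?_ ?_⟩ <;> grind

theorem diagPlane_equiv_of_cubic_equiv {a b c e d f a' b' c' e' d' f' p q s t ρ : F}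
    (he : e = a * d + b * c) (hd : d = a * f + b * e) (hD : c * f + e * d ≠ 0)
    (he' : e' = a' * d' + b' * c') (hd' : d' = a' * f' + b' * e')
    (hρ : ρ ≠ 0) (hΔ : p * t + q * s ≠ 0)
    (h1 : ρ * c = c' * p ^ 3 + e' * p ^ 2 * s + d' * p * s ^ 2 + f' * s ^ 3)
    (h2 : ρ * e = p ^ 2 * (c' * q + e' * t) + s ^ 2 * (d' * q + f' * t))
    (h3 : ρ * d = q ^ 2 * (c' * p + e' * s) + t ^ 2 * (d' * p + f' * s))
    (h4 : ρ * f = c' * q ^ 3 + e' * q ^ 2 * t + d' * q * t ^ 2 + f' * t ^ 3) :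
    CongruenceEquiv F (diagPlane a b c e d f) (diagPlane a' b' c' e' d' f') := by
  have hD1 : ρ ^ 2 * (c * f + e * d) = (p * t + q * s) ^ 3 * (c' * f' + e' * d') := by
    have : ρ ^ 2 * (c * f + e * d) = (ρ * c) * (ρ * f) + (ρ * e) * (ρ * d) := by ring
    rw [this, h1, h2, h3, h4]
    grind
  have ha : a * (c * f + e * d) = c * d + e ^ 2 := by grind
  have hb : b * (c * f + e * d) = e * f + d ^ 2 := by grind
  have ha' : a' * (c' * f' + e' * d') = c' * d' + e' ^ 2 := by grind
  have hb' : b' * (c' * f' + e' * d') = e' * f' + d' ^ 2 := by grind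
  have hD2 : ρ ^ 2 * (c * f + e * d) ≠ 0 := mul_ne_zero (pow_ne_zero 2 hρ) hD
  have hA : ρ ^ 2 * (c * f + e * d) * a = (ρ * c) * (ρ * d) + (ρ * e) ^ 2 := by
    linear_combination ρ ^ 2 * ha
  have hB : ρ ^ 2 * (c * f + e * d) * b = (ρ * e) * (ρ * f) + (ρ * d) ^ 2 := by
    linear_combination ρ ^ 2 * hb
  rw [h1, h2, h3] at hA
  rw [h2, h3, h4] at hB
  set Δ := p * t + q * s with hΔ'
  refine diagPlane_equiv (ρ / Δ) 0 0 p q s t (div_ne_zero hρ hΔ) hΔ ?_ ?_ ?_ ?_ ?_ ?_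
  · apply mul_left_cancel₀ hD2
    have : ρ ^ 2 * (c * f + e * d) * (a' * p ^ 2 + b' * s ^ 2) =
        Δ ^ 3 * ((c' * d' + e' ^ 2) * p ^ 2 + (e' * f' + d' ^ 2) * s ^ 2) := by
      rw [hD1]; linear_combination Δ ^ 3 * (p ^ 2 * ha' + s ^ 2 * hb')
    rw [this, mul_add, mul_left_comm _ Δ a, hA, hD1]
    grind
  · apply mul_left_cancel₀ hD2
    have : ρ ^ 2 * (c * f + e * d) * (a' * q ^ 2 + b' * t ^ 2) =
        Δ ^ 3 * ((c' * d' + e' ^ 2) * q ^ 2 + (e' * f' + d' ^ 2) * t ^ 2) := by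
      rw [hD1]; linear_combination Δ ^ 3 * (q ^ 2 * ha' + t ^ 2 * hb')
    rw [this, mul_add, mul_left_comm _ Δ b, hB, hD1]
    grind
  · field_simp
    linear_combination (norm := skip) p * h2 + q * h1
    grind
  · field_simp
    linear_combination (norm := skip) p * h4 + q * h3
    grind
  · field_simp
    linear_combination (norm := skip) s * h2 + t * h1
    grind
  · field_simp
    linear_combination (norm := skip) s * h4 + t * h3
    grind

/-- Representatives of the orbits of planes meeting the Veronese surface: `δ` is a parameter for
which `y² + y z + δ z²` is anisotropic, and `σ` one for which `y³ + y z² + σ z³` has no zero. -/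
def representative (δ σ : F) : Fin 15 → Submodule F (Matrix (Fin 3) (Fin 3) F) :=
  ![plane 0 0 0 1 0 0 0 0 0 1,
    plane 0 0 1 0 0 0 0 0 0 1,
    plane 1 0 0 0 0 0 0 0 0 1,
    plane 1 0 0 1 0 0 0 0 0 1,
    plane 1 0 1 0 0 0 0 0 0 1,
    plane 1 0 0 0 0 0 0 0 1 0,
    plane 1 0 1 0 0 0 0 0 1 0,
    plane 1 0 0 0 1 0 0 1 0 0,
    plane 1 0 0 1 0 0 0 1 0 0,
    diagPlane 0 0 0 0 0 0,
    diagPlane 0 0 1 0 0 0,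
    diagPlane 1 δ 0 0 0 0,
    diagPlane 1 1 0 1 1 0,
    diagPlane (δ + 1) 1 δ 1 1 0,
    diagPlane σ⁻¹ σ⁻¹ 1 0 1 σ]

theorem diagPlane_equiv_of_cubic_zero {δ : F} (hδ : ∀ c : F, ∃ m, m ^ 2 + m = c ∨ m ^ 2 + m = c + δ)
    (a b : F) : CongruenceEquiv F (diagPlane a b 0 0 0 0) (diagPlane 0 0 0 0 0 0) ∨
      CongruenceEquiv F (diagPlane a b 0 0 0 0) (diagPlane 1 δ 0 0 0 0) := by
  by_cases ha : a = 0
  · left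
    refine diagPlane_equiv 1 0 0 1 b 0 1 one_ne_zero ?_ ?_ ?_ ?_ ?_ ?_ ?_ <;>
      simp [ha, CharTwo.add_self_eq_zero]
  obtain ⟨m, hm | hm⟩ := hδ (a * b)
  · left
    refine diagPlane_equiv 1 0 0 a m a (m + 1) one_ne_zero ?_ ?_ ?_ ?_ ?_ ?_ ?_ <;> grind
  · right
    refine diagPlane_equiv 1 0 0 a m 0 1 one_ne_zero ?_ ?_ ?_ ?_ ?_ ?_ ?_ <;> grind

theorem diagPlane_equiv_of_cubic_cube {a b c e d f : F}
    (he : e = a * d + b * c) (hd : d = a * f + b * e) (hD : c * f + e * d = 0)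
    (hne : c ≠ 0 ∨ f ≠ 0) :
    CongruenceEquiv F (diagPlane a b c e d f) (diagPlane 0 0 1 0 0 0) := by
  have h1 : c * d = e ^ 2 := by grind
  have h2 : e * f = d ^ 2 := by grind
  by_cases hc : c = 0
  · have hf : f ≠ 0 := by simpa [hc] using hne
    have he0 : e = 0 := by simpa [hc] using h1.symm
    have hd0 : d = 0 := by simpa [he0] using h2.symm
    have ha : a = 0 := by grind
    refine diagPlane_equiv f⁻¹ 0 0 0 1 1 b (inv_ne_zero hf) ?_ ?_ ?_ ?_ ?_ ?_ ?_ <;>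
      simp [hc, he0, hd0, ha, hf, CharTwo.add_self_eq_zero]
  · refine diagPlane_equiv c⁻¹ 0 0 1 (e / c) a (1 + a * (e / c)) (inv_ne_zero hc)
      ?_ ?_ ?_ ?_ ?_ ?_ ?_ <;> grind

theorem diagPlane_equiv_of_root_at_infinity {δ : F}
    (hδ : ∀ c : F, ∃ m, m ^ 2 + m = c ∨ m ^ 2 + m = c + δ) {a b c e d : F}
    (he : e = a * d + b * c) (hd : d = b * e) (hD : e * d ≠ 0) :
    CongruenceEquiv F (diagPlane a b c e d 0) (diagPlane 1 1 0 1 1 0) ∨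
      CongruenceEquiv F (diagPlane a b c e d 0) (diagPlane (δ + 1) 1 δ 1 1 0) := by
  have he0 : e ≠ 0 := left_ne_zero_of_mul hD
  have hd0 : d ≠ 0 := right_ne_zero_of_mul hD
  have key (c₀ m : F) (hm : m ^ 2 + m = c * d / e ^ 2 + c₀) :
      CongruenceEquiv F (diagPlane a b c e d 0) (diagPlane (c₀ + 1) 1 c₀ 1 1 0) := by
    refine diagPlane_equiv e⁻¹ 0 0 1 0 m (d / e) (inv_ne_zero he0) ?_ ?_ ?_ ?_ ?_ ?_ ?_ <;> grind
  obtain ⟨m, hm | hm⟩ := hδ (c * d / e ^ 2)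
  · left
    simpa using key 0 m (by simpa using hm)
  · exact Or.inr (key δ m hm)

theorem diagPlane_equiv_of_root {δ : F}
    (hδ : ∀ c : F, ∃ m, m ^ 2 + m = c ∨ m ^ 2 + m = c + δ) {a b c e d f : F}
    (he : e = a * d + b * c) (hd : d = a * f + b * e) (hD : c * f + e * d ≠ 0)
    {y z : F} (hyz : y ≠ 0 ∨ z ≠ 0)
    (hroot : c * y ^ 3 + e * y ^ 2 * z + d * y * z ^ 2 + f * z ^ 3 = 0) :
    CongruenceEquiv F (diagPlane a b c e d f) (diagPlane 1 1 0 1 1 0) ∨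
      CongruenceEquiv F (diagPlane a b c e d f) (diagPlane (δ + 1) 1 δ 1 1 0) := by
  suffices h : ∃ a' b' c' e' d', e' = a' * d' + b' * c' ∧ d' = b' * e' ∧ e' * d' ≠ 0 ∧
      CongruenceEquiv F (diagPlane a b c e d f) (diagPlane a' b' c' e' d' 0) by
    obtain ⟨a', b', c', e', d', h1, h2, h3, h4⟩ := h
    exact (diagPlane_equiv_of_root_at_infinity hδ h1 h2 h3).imp
      (congruenceEquiv_trans h4) (congruenceEquiv_trans h4)
  by_cases hz : z = 0
  · have hy : y ≠ 0 := by simpa [hz] using hyz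
    have hc : c = 0 := by simpa [hz, hy] using hroot
    refine ⟨b, a, f, d, e, by grind, by grind, by grind,
      diagPlane_equiv 1 0 0 0 1 1 0 one_ne_zero ?_ ?_ ?_ ?_ ?_ ?_ ?_⟩ <;> grind
  · obtain ⟨θ, hθ⟩ : ∃ θ, y = θ * z := ⟨y / z, by field_simp⟩
    have hroot' : c * θ ^ 3 + e * θ ^ 2 + d * θ + f = 0 := by
      have : z ^ 3 * (c * θ ^ 3 + e * θ ^ 2 + d * θ + f) = 0 := by
        rw [← hroot, hθ]; ring
      exact (mul_eq_zero.1 this).resolve_left (pow_ne_zero 3 hz)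
    refine ⟨a, b + θ + a * θ ^ 2, c, e + θ * c, d + c * θ ^ 2, by grind, by grind, by grind,
      diagPlane_equiv 1 0 0 1 θ 0 1 one_ne_zero ?_ ?_ ?_ ?_ ?_ ?_ ?_⟩ <;> grind

/-! ### Binary cubic forms without roots -/

open Polynomial in
theorem exists_cubic_extension {F : Type} [Field F] [Finite F] {c e d f c' e' d' f' : F}
    (h : ∀ y z : F, y ≠ 0 ∨ z ≠ 0 →
      c * y ^ 3 + e * y ^ 2 * z + d * y * z ^ 2 + f * z ^ 3 ≠ 0)
    (h' : ∀ y z : F, y ≠ 0 ∨ z ≠ 0 →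
      c' * y ^ 3 + e' * y ^ 2 * z + d' * y * z ^ 2 + f' * z ^ 3 ≠ 0) :
    ∃ (K : Type) (_ : Field K) (ι : F →+* K) (θ θ' : K),
      ι c * θ ^ 3 + ι e * θ ^ 2 + ι d * θ + ι f = 0 ∧
      ι c' * θ' ^ 3 + ι e' * θ' ^ 2 + ι d' * θ' + ι f' = 0 ∧
      (∀ u v w : F, ι u * θ ^ 2 + ι v * θ + ι w = 0 → u = 0 ∧ v = 0 ∧ w = 0) ∧
      ∃ p q s t : F, θ' * (ι s * θ + ι t) = ι p * θ + ι q ∧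
        ¬ (p = 0 ∧ q = 0 ∧ s = 0 ∧ t = 0) := by
  have irr {c e d f : F} (h : ∀ y z : F, y ≠ 0 ∨ z ≠ 0 →
      c * y ^ 3 + e * y ^ 2 * z + d * y * z ^ 2 + f * z ^ 3 ≠ 0) :
      (C c * X ^ 3 + C e * X ^ 2 + C d * X + C f).natDegree = 3 ∧
        Irreducible (C c * X ^ 3 + C e * X ^ 2 + C d * X + C f) := by
    have hc : c ≠ 0 := by simpa using h 1 0 (by simp)
    have hdeg : (C c * X ^ 3 + C e * X ^ 2 + C d * X + C f).natDegree = 3 := natDegree_cubic hc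
    refine ⟨hdeg, irreducible_of_degree_le_three_of_not_isRoot (by simp [hdeg]) fun x hx => ?_⟩
    exact h x 1 (by simp) (by simpa [IsRoot] using hx)
  obtain ⟨hdeg, hirr⟩ := irr h
  obtain ⟨hdeg', hirr'⟩ := irr h'
  obtain ⟨g, hg⟩ : ∃ g, g = C c * X ^ 3 + C e * X ^ 2 + C d * X + C f := ⟨_, rfl⟩
  obtain ⟨g', hg'⟩ : ∃ g', g' = C c' * X ^ 3 + C e' * X ^ 2 + C d' * X + C f' := ⟨_, rfl⟩
  rw [← hg] at hdeg hirr
  rw [← hg'] at hdeg' hirr'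
  have := Fact.mk hirr
  have := Fact.mk hirr'
  have hfin : finrank F (AdjoinRoot g) = 3 := by
    rw [(AdjoinRoot.powerBasis hirr.ne_zero).finrank, AdjoinRoot.powerBasis_dim, hdeg]
  have hfin' : finrank F (AdjoinRoot g') = 3 := by
    rw [(AdjoinRoot.powerBasis hirr'.ne_zero).finrank, AdjoinRoot.powerBasis_dim, hdeg']
  have : FiniteDimensional F (AdjoinRoot g) := .of_finrank_pos (by simp [hfin])
  have : FiniteDimensional F (AdjoinRoot g') := .of_finrank_pos (by simp [hfin'])
  have : Finite (AdjoinRoot g) := Module.finite_of_finite F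
  obtain ⟨φ⟩ := FiniteField.nonempty_algHom_of_finrank_dvd (F := F) (K := AdjoinRoot g')
    (L := AdjoinRoot g) (by rw [hfin, hfin'])
  refine ⟨AdjoinRoot g, inferInstance, AdjoinRoot.of g, AdjoinRoot.root g,
    φ (AdjoinRoot.root g'), ?_, ?_, ?_, ?_⟩
  · have h1 := AdjoinRoot.eval₂_root g
    generalize AdjoinRoot.root g = x at h1
    generalize AdjoinRoot.of g = ι at h1
    have h2 := (congrArg (eval₂ ι x) hg).symm.trans h1
    simpa only [eval₂_add, eval₂_mul, eval₂_C, eval₂_X, eval₂_pow] using h2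
  · have h1 := AdjoinRoot.eval₂_root g'
    have h2 : φ (eval₂ (AdjoinRoot.of g') (AdjoinRoot.root g') g') =
        eval₂ (AdjoinRoot.of g) (φ (AdjoinRoot.root g')) g' := by
      rw [← AdjoinRoot.algebraMap_eq, ← AdjoinRoot.algebraMap_eq, ← aeval_def, ← aeval_def,
        aeval_algHom_apply]
    rw [h1, map_zero] at h2
    generalize φ (AdjoinRoot.root g') = x at h2
    rw [hg'] at h2
    simpa only [eval₂_add, eval₂_mul, eval₂_C, eval₂_X, eval₂_pow] using h2.symm
  · intro u v w huvw
    have hdvd : g ∣ C u * X ^ 2 + C v * X + C w := by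
      rw [← AdjoinRoot.mk_eq_zero]
      simpa using huvw
    have h0 := eq_zero_of_dvd_of_natDegree_lt hdvd (by
      rw [hdeg]; exact lt_of_le_of_lt natDegree_quadratic_le (by norm_num))
    refine ⟨?_, ?_, ?_⟩
    · simpa using congrArg (fun P => coeff P 2) h0
    · simpa using congrArg (fun P => coeff P 1) h0
    · simpa using congrArg (fun P => coeff P 0) h0
  · generalize φ (AdjoinRoot.root g') = θ'
    generalize AdjoinRoot.root g = θ
    have hdep : ¬ LinearIndependent F ![θ, 1, -(θ' * θ), -θ'] := fun hli => by
      simpa [hfin] using hli.fintype_card_le_finrank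
    obtain ⟨w, hw, i, hi⟩ := Fintype.not_linearIndependent_iff.1 hdep
    refine ⟨w 0, w 1, w 2, w 3, ?_, ?_⟩
    · simp only [Fin.sum_univ_four, Algebra.smul_def, AdjoinRoot.algebraMap_eq, cons_val_zero,
        cons_val_one, cons_val] at hw
      linear_combination -hw
    · rintro ⟨h0, h1, h2, h3⟩
      fin_cases i <;> simp_all

/-- Over a finite field any two binary cubic forms without roots are equivalent up to a factor. -/
theorem exists_moebius_of_irreducible [Finite F] {c e d f c' e' d' f' : F}
    (h : ∀ y z : F, y ≠ 0 ∨ z ≠ 0 →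
      c * y ^ 3 + e * y ^ 2 * z + d * y * z ^ 2 + f * z ^ 3 ≠ 0)
    (h' : ∀ y z : F, y ≠ 0 ∨ z ≠ 0 →
      c' * y ^ 3 + e' * y ^ 2 * z + d' * y * z ^ 2 + f' * z ^ 3 ≠ 0) :
    ∃ p q s t ρ : F, ρ ≠ 0 ∧ p * t + q * s ≠ 0 ∧
      ρ * c = c' * p ^ 3 + e' * p ^ 2 * s + d' * p * s ^ 2 + f' * s ^ 3 ∧
      ρ * e = p ^ 2 * (c' * q + e' * t) + s ^ 2 * (d' * q + f' * t) ∧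
      ρ * d = q ^ 2 * (c' * p + e' * s) + t ^ 2 * (d' * p + f' * s) ∧
      ρ * f = c' * q ^ 3 + e' * q ^ 2 * t + d' * q * t ^ 2 + f' * t ^ 3 := by
  obtain ⟨K, _, ι, θ, θ', hθ, hθ', indep, p, q, s, t, hrel, hne⟩ := exists_cubic_extension h h'
  have : CharP K 2 := charP_of_injective_ringHom ι.injective 2
  have hc : c ≠ 0 := by simpa using h 1 0 (by simp)
  have hst : ι s * θ + ι t ≠ 0 := by
    intro h0
    have h1 := indep 0 s t (by simpa using h0)
    rw [h0, mul_zero] at hrel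
    have h2 := indep 0 p q (by simpa using hrel.symm)
    exact hne ⟨h2.2.1, h2.2.2, h1.2.1, h1.2.2⟩
  have hΔ : p * t + q * s ≠ 0 := by
    intro h0
    obtain ⟨k, hk⟩ : ∃ k, p = k * s ∧ q = k * t := by
      have hst' : ¬(s = 0 ∧ t = 0) := by
        rintro ⟨rfl, rfl⟩
        simp at hst
      clear hrel hst hθ hθ' indep
      by_cases hs : s = 0
      · have ht : t ≠ 0 := by
          rintro rfl
          exact hst' ⟨hs, rfl⟩
        exact ⟨q / t, by grind, by grind⟩
      · exact ⟨p / s, by grind, by grind⟩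
    have : θ' = ι k := by
      apply mul_right_cancel₀ hst
      rw [hrel, hk.1, hk.2, map_mul, map_mul]
      ring
    rw [this] at hθ'
    refine h' k 1 (by simp) (ι.injective ?_)
    simpa using hθ'
  have hP3 : c' * p ^ 3 + e' * p ^ 2 * s + d' * p * s ^ 2 + f' * s ^ 3 ≠ 0 := by
    apply h'
    by_contra! h0
    simp [h0] at hΔ
  obtain ⟨ρ, hρ⟩ : ∃ ρ, ρ * c = c' * p ^ 3 + e' * p ^ 2 * s + d' * p * s ^ 2 + f' * s ^ 3 :=
    ⟨_ / c, div_mul_cancel₀ _ hc⟩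
  have hρ0 : ρ ≠ 0 := by
    rintro rfl
    exact hP3 (by rw [← hρ, zero_mul])
  have hcub : ι c' * (ι p * θ + ι q) ^ 3 + ι e' * (ι p * θ + ι q) ^ 2 * (ι s * θ + ι t) +
      ι d' * (ι p * θ + ι q) * (ι s * θ + ι t) ^ 2 + ι f' * (ι s * θ + ι t) ^ 3 = 0 := by
    rw [← hrel]
    linear_combination (ι s * θ + ι t) ^ 3 * hθ'
  have hquad := indep
    (ρ * e + (p ^ 2 * (c' * q + e' * t) + s ^ 2 * (d' * q + f' * t)))
    (ρ * d + (q ^ 2 * (c' * p + e' * s) + t ^ 2 * (d' * p + f' * s)))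
    (ρ * f + (c' * q ^ 3 + e' * q ^ 2 * t + d' * q * t ^ 2 + f' * t ^ 3)) (by
      have hρ' := congrArg ι hρ
      simp only [map_add, map_mul, map_pow] at hρ' ⊢
      clear indep hrel hst hP3 hρ hne h h' hθ'
      linear_combination (norm := skip) hcub + ι ρ * hθ + θ ^ 3 * hρ'
      grind)
  exact ⟨p, q, s, t, ρ, hρ0, hΔ, hρ, CharTwo.add_eq_zero.1 hquad.1,
    CharTwo.add_eq_zero.1 hquad.2.1, CharTwo.add_eq_zero.1 hquad.2.2⟩

/-! ### Parameters -/

theorem exists_artin_schreier_parameter (F : Type) [Field F] [CharP F 2] [Finite F] :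
    ∃ δ : F, (∀ m, m ^ 2 + m ≠ δ) ∧ ∀ c : F, ∃ m, m ^ 2 + m = c ∨ m ^ 2 + m = c + δ := by
  let φ : F →+ F := ⟨⟨fun m => m ^ 2 + m, by simp⟩, fun x y => by grind⟩
  have hφ (m : F) : φ m = m ^ 2 + m := rfl
  have hker : (φ.ker : Set F) = {0, 1} := by
    ext m
    simp only [SetLike.mem_coe, AddMonoidHom.mem_ker, hφ, Set.mem_insert_iff,
      Set.mem_singleton_iff]
    grind
  have hidx : φ.range.index = 2 := by
    rw [AddSubgroup.index_range, ← SetLike.coe_sort_coe, hker, Nat.card_coe_set_eq,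
      Set.ncard_pair zero_ne_one]
  obtain ⟨δ, hδ⟩ := AddSubgroup.index_eq_two_iff.1 hidx
  refine ⟨δ, fun m hm => ?_, fun c => ?_⟩
  · have h0 := hδ 0
    rw [zero_add, xor_iff_iff_not] at h0
    exact h0.1 ⟨m, hm⟩ (zero_mem _)
  · rcases hδ c with ⟨⟨m, hm⟩, -⟩ | ⟨⟨m, hm⟩, -⟩
    · exact ⟨m, .inr hm⟩
    · exact ⟨m, .inl hm⟩

theorem exists_cubic_parameter (F : Type) [Field F] [CharP F 2] [Finite F] :
    ∃ σ : F, σ ≠ 0 ∧ ∀ y z : F, y ≠ 0 ∨ z ≠ 0 →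
      1 * y ^ 3 + 0 * y ^ 2 * z + 1 * y * z ^ 2 + σ * z ^ 3 ≠ 0 := by
  have hinj : ¬ Function.Injective fun t : F => t ^ 3 + t := fun h =>
    zero_ne_one (h (a₁ := 0) (a₂ := 1) (by grind))
  have hsurj : ¬ Function.Surjective fun t : F => t ^ 3 + t := fun h =>
    hinj (Finite.injective_iff_surjective.2 h)
  simp only [Function.Surjective, not_forall, not_exists] at hsurj
  obtain ⟨σ, hσ⟩ := hsurj
  refine ⟨σ, fun h => hσ 0 (by simp [h]), fun y z hyz h => ?_⟩
  by_cases hz : z = 0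
  · simp_all
  · refine hσ (y / z) ?_
    field_simp
    grind

theorem exists_sq_eq [Finite F] (x : F) : ∃ y, y ^ 2 = x := by
  obtain ⟨y, hy⟩ := isSquare_of_charTwo' x
  exact ⟨y, by rw [hy, sq]⟩

/-! ### Moving a rank-one matrix to `E₁₁` -/

theorem rank_symMat_eq_one_iff {X Y Z p q r : F} : (symMat X Y Z p q r).rank = 1 ↔
    symMat X Y Z p q r ≠ 0 ∧ Y * Z = p ^ 2 ∧ X * Z = q ^ 2 ∧ X * Y = r ^ 2 ∧
      X * p = q * r ∧ Y * q = p * r ∧ Z * r = p * q := by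
  constructor
  · intro h
    refine ⟨fun h0 => by simp [h0] at h, ?_⟩
    obtain ⟨v, -, hv⟩ := finrank_eq_one_iff'.1 h
    choose k hk using fun j => hv ⟨_, Pi.single j 1, rfl⟩
    have hM (i j) : k j * v.1 i = symMat X Y Z p q r i j := by
      have := congrFun (congrArg Subtype.val (hk j)) i
      simpa using this
    have h00 := hM 0 0
    have h01 := hM 0 1
    have h02 := hM 0 2
    have h10 := hM 1 0
    have h11 := hM 1 1
    have h12 := hM 1 2
    have h20 := hM 2 0
    have h21 := hM 2 1
    have h22 := hM 2 2
    simp [symMat] at h00 h01 h02 h10 h11 h12 h20 h21 h22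
    generalize k 0 = k0 at *
    generalize k 1 = k1 at *
    generalize k 2 = k2 at *
    generalize v.1 0 = v0 at *
    generalize v.1 1 = v1 at *
    generalize v.1 2 = v2 at *
    clear hv hk hM h
    refine ⟨?_, ?_, ?_, ?_, ?_, ?_⟩ <;> grind
  · rintro ⟨h0, h1, h2, h3, h4, h5, h6⟩
    have hle : (symMat X Y Z p q r).rank ≤ 1 := by
      have hd : X ≠ 0 ∨ Y ≠ 0 ∨ Z ≠ 0 := by
        by_contra! h
        obtain ⟨rfl, rfl, rfl⟩ := h
        refine h0 (symMat_eq_zero.2 ⟨rfl, rfl, rfl, ?_, ?_, ?_⟩) <;> grind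
      rcases hd with h | h | h
      · have : symMat X Y Z p q r = vecMulVec ![X, r, q] ![1, r / X, q / X] := by
          ext i j
          fin_cases i <;> fin_cases j <;> simp [symMat, vecMulVec_apply] <;> grind
        exact this ▸ rank_vecMulVec_le _ _
      · have : symMat X Y Z p q r = vecMulVec ![r, Y, p] ![r / Y, 1, p / Y] := by
          ext i j
          fin_cases i <;> fin_cases j <;> simp [symMat, vecMulVec_apply] <;> grind
        exact this ▸ rank_vecMulVec_le _ _
      · have : symMat X Y Z p q r = vecMulVec ![q, p, Z] ![q / Z, p / Z, 1] := by
          ext i j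
          fin_cases i <;> fin_cases j <;> simp [symMat, vecMulVec_apply] <;> grind
        exact this ▸ rank_vecMulVec_le _ _
    have hne : (symMat X Y Z p q r).rank ≠ 0 := fun h => h0 (by
      have h' := LinearMap.range_eq_bot.1 (Submodule.finrank_eq_zero.1 h)
      ext i j
      simpa using congrFun (congrArg (fun g => g (Pi.single j 1)) h') i)
    omega

theorem exists_congruence_symMat_one {M : Matrix (Fin 3) (Fin 3) F} (hM : M.IsSymm)
    (hr : M.rank = 1) : ∃ (A : Matrix (Fin 3) (Fin 3) F) (x : F), A.det ≠ 0 ∧ x ≠ 0 ∧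
      A * M * Aᵀ = x • symMat 1 0 0 0 0 0 := by
  obtain ⟨X, Y, Z, p, q, r, rfl⟩ := exists_eq_symMat hM
  obtain ⟨h0, h1, h2, h3, h4, h5, h6⟩ := rank_symMat_eq_one_iff.1 hr
  have hd : X ≠ 0 ∨ Y ≠ 0 ∨ Z ≠ 0 := by
    by_contra! h
    obtain ⟨rfl, rfl, rfl⟩ := h
    refine h0 (symMat_eq_zero.2 ⟨rfl, rfl, rfl, ?_, ?_, ?_⟩) <;> grind
  clear h0 hM hr
  rcases hd with h | h | h
  · refine ⟨!![1, 0, 0; r, X, 0; q, 0, X], X, by simp [det_fin_three, h], h, ?_⟩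
    ext i j
    fin_cases i <;> fin_cases j <;> simp [symMat, Matrix.mul_apply, Fin.sum_univ_three] <;> grind
  · refine ⟨!![0, 1, 0; Y, r, 0; 0, p, Y], Y, by simp [det_fin_three, h], h, ?_⟩
    ext i j
    fin_cases i <;> fin_cases j <;> simp [symMat, Matrix.mul_apply, Fin.sum_univ_three] <;> grind
  · refine ⟨!![0, 0, 1; Z, 0, q; 0, Z, p], Z, by simp [det_fin_three, h], h, ?_⟩
    ext i j
    fin_cases i <;> fin_cases j <;> simp [symMat, Matrix.mul_apply, Fin.sum_univ_three] <;> grind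

theorem eq_plane_of_symMat_one_mem {W : Submodule F (Matrix (Fin 3) (Fin 3) F)}
    (hW : finrank F W = 3) (hs : ∀ M ∈ W, M.IsSymm) (h1 : symMat 1 0 0 0 0 0 ∈ W) :
    ∃ Y₁ Z₁ p₁ q₁ r₁ Y₂ Z₂ p₂ q₂ r₂, finrank F (plane Y₁ Z₁ p₁ q₁ r₁ Y₂ Z₂ p₂ q₂ r₂) = 3 ∧
      W = plane Y₁ Z₁ p₁ q₁ r₁ Y₂ Z₂ p₂ q₂ r₂ := by
  classical
  have ex (S : Finset (Matrix (Fin 3) (Fin 3) F)) (hS : S.card < 3) :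
      ∃ Y Z p q r, symMat 0 Y Z p q r ∈ W ∧
        (symMat 1 0 0 0 0 0 ∈ S → symMat 0 Y Z p q r ∉ Submodule.span F (S : Set _)) := by
    obtain ⟨M, hM, hMS⟩ : ∃ M ∈ W, M ∉ Submodule.span F (S : Set _) := by
      by_contra! h
      have := (Submodule.finrank_mono (show W ≤ _ from h)).trans (finrank_span_finset_le_card S)
      omega
    obtain ⟨X, Y, Z, p, q, r, rfl⟩ := exists_eq_symMat (hs M hM)
    have h0 : symMat X Y Z p q r = symMat 0 Y Z p q r + X • symMat 1 0 0 0 0 0 := by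
      rw [smul_symMat, symMat_add]; simp
    refine ⟨Y, Z, p, q, r, ?_, fun h1S hmem => hMS ?_⟩
    · rw [eq_sub_of_add_eq h0.symm]
      exact sub_mem hM (W.smul_mem X h1)
    · rw [h0]
      exact add_mem hmem (Submodule.smul_mem _ X (Submodule.subset_span h1S))
  obtain ⟨Y₁, Z₁, p₁, q₁, r₁, hM, hM'⟩ := ex {symMat 1 0 0 0 0 0} (by simp)
  obtain ⟨Y₂, Z₂, p₂, q₂, r₂, hN, hN'⟩ := ex {symMat 1 0 0 0 0 0, symMat 0 Y₁ Z₁ p₁ q₁ r₁}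
    (lt_of_le_of_lt Finset.card_le_two (by norm_num))
  replace hM' := hM' (by simp)
  replace hN' := hN' (by simp)
  have hle : plane Y₁ Z₁ p₁ q₁ r₁ Y₂ Z₂ p₂ q₂ r₂ ≤ W := by
    rw [plane, Submodule.span_le]
    rintro M (rfl | rfl | rfl) <;> assumption
  have hfin : finrank F (plane Y₁ Z₁ p₁ q₁ r₁ Y₂ Z₂ p₂ q₂ r₂) = 3 := by
    refine finrank_plane_eq_three_iff.2 fun y z e1 e2 e3 e4 e5 => ?_
    have hz : z = 0 := by
      by_contra hz
      have : symMat 0 Y₂ Z₂ p₂ q₂ r₂ = (y / z) • symMat 0 Y₁ Z₁ p₁ q₁ r₁ := by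
        rw [smul_symMat, symMat_inj]
        refine ⟨by simp, ?_, ?_, ?_, ?_, ?_⟩ <;> field_simp <;> grind
      exact hN' (this ▸ Submodule.smul_mem _ _ (Submodule.subset_span (by simp)))
    refine ⟨?_, hz⟩
    by_contra hy
    have : symMat 0 Y₁ Z₁ p₁ q₁ r₁ = 0 := by
      rw [symMat_eq_zero]
      simp_all
    exact hM' (this ▸ zero_mem _)
  exact ⟨Y₁, Z₁, p₁, q₁, r₁, Y₂, Z₂, p₂, q₂, r₂, hfin,
    (Submodule.eq_of_le_of_finrank_eq hle (hfin.trans hW.symm)).symm⟩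

theorem exists_plane_of_isRankOnePlane {W : Submodule F (Matrix (Fin 3) (Fin 3) F)}
    (hW : IsRankOnePlane F W) :
    ∃ Y₁ Z₁ p₁ q₁ r₁ Y₂ Z₂ p₂ q₂ r₂, finrank F (plane Y₁ Z₁ p₁ q₁ r₁ Y₂ Z₂ p₂ q₂ r₂) = 3 ∧
      CongruenceEquiv F W (plane Y₁ Z₁ p₁ q₁ r₁ Y₂ Z₂ p₂ q₂ r₂) := by
  obtain ⟨hfin, hs, M, hM, hr⟩ := hW
  obtain ⟨A, x, hA, hx, h⟩ := exists_congruence_symMat_one (hs M hM) hr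
  have hfin' : finrank F (W.map (congruenceLin A)) = 3 :=
    (Submodule.equivMapOfInjective _ (congruence_injective hA) W).finrank_eq.symm.trans hfin
  have hequiv : CongruenceEquiv F W (W.map (congruenceLin A)) :=
    congruenceEquiv_of_forall_mem hA (by rw [hfin, hfin']) fun M hM => ⟨M, hM, rfl⟩
  obtain ⟨Y₁, Z₁, p₁, q₁, r₁, Y₂, Z₂, p₂, q₂, r₂, h1, h2⟩ := eq_plane_of_symMat_one_mem hfin'
    (by
      rintro _ ⟨M, hM, rfl⟩
      rw [congruenceLin_apply, IsSymm, transpose_mul, transpose_mul, transpose_transpose, hs M hM,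
        Matrix.mul_assoc])
    (by
      have : symMat 1 0 0 0 0 0 = congruenceLin A (x⁻¹ • M) := by
        rw [map_smul, congruenceLin_apply, h, smul_smul, inv_mul_cancel₀ hx, one_smul]
      exact ⟨_, W.smul_mem _ hM, this.symm⟩)
  exact ⟨Y₁, Z₁, p₁, q₁, r₁, Y₂, Z₂, p₂, q₂, r₂, h1, h2 ▸ hequiv⟩

/-! ### Every plane is equivalent to a representative -/

theorem plane_equiv_diagPlane {Y₁ Z₁ p₁ q₁ r₁ Y₂ Z₂ p₂ q₂ r₂ : F}
    (hW : finrank F (plane Y₁ Z₁ p₁ q₁ r₁ Y₂ Z₂ p₂ q₂ r₂) = 3) (hD : Y₁ * Z₂ + Y₂ * Z₁ ≠ 0) :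
    ∃ a b c e d f, CongruenceEquiv F (plane Y₁ Z₁ p₁ q₁ r₁ Y₂ Z₂ p₂ q₂ r₂)
      (diagPlane a b c e d f) := by
  refine ⟨(p₁ * Z₂ + p₂ * Z₁) / (Y₁ * Z₂ + Y₂ * Z₁), (p₁ * Y₂ + p₂ * Y₁) / (Y₁ * Z₂ + Y₂ * Z₁),
    (q₁ * Z₂ + q₂ * Z₁) / (Y₁ * Z₂ + Y₂ * Z₁), (r₁ * Z₂ + r₂ * Z₁) / (Y₁ * Z₂ + Y₂ * Z₁),
    (q₁ * Y₂ + q₂ * Y₁) / (Y₁ * Z₂ + Y₂ * Z₁), (r₁ * Y₂ + r₂ * Y₁) / (Y₁ * Z₂ + Y₂ * Z₁),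
    plane_equiv 1 0 0 1 0 0 1 hW one_ne_zero (by simp) (symMat_mem_plane.2 ⟨Y₁, Z₁, ?_⟩)
      (symMat_mem_plane.2 ⟨Y₂, Z₂, ?_⟩)⟩ <;>
  refine ⟨by ring, by ring, ?_, ?_, ?_⟩ <;> field_simp <;> grind

theorem diagPlane_equiv_representative [Finite F] {δ σ : F}
    (hδ : ∀ c : F, ∃ m, m ^ 2 + m = c ∨ m ^ 2 + m = c + δ) (hσ0 : σ ≠ 0)
    (hσ : ∀ y z : F, y ≠ 0 ∨ z ≠ 0 →
      1 * y ^ 3 + 0 * y ^ 2 * z + 1 * y * z ^ 2 + σ * z ^ 3 ≠ 0) (a b c e d f : F) :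
    ∃ i, CongruenceEquiv F (diagPlane a b c e d f) (representative δ σ i) := by
  suffices h : ∀ c e d f, e = a * d + b * c → d = a * f + b * e →
      ∃ i, CongruenceEquiv F (diagPlane a b c e d f) (representative δ σ i) by
    obtain ⟨c', e', d', f', h1, h2, h3⟩ := diagPlane_equiv_apolar a b c e d f
    obtain ⟨i, hi⟩ := h c' e' d' f' h1 h2
    exact ⟨i, congruenceEquiv_trans h3 hi⟩
  clear c e d f
  intro c e d f he hd
  by_cases hD : c * f + e * d = 0
  · by_cases hcf : c = 0 ∧ f = 0
    · obtain ⟨rfl, rfl⟩ := hcf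
      have he0 : e = 0 := by grind
      have hd0 : d = 0 := by grind
      subst he0 hd0
      exact (diagPlane_equiv_of_cubic_zero hδ a b).elim (fun h => ⟨9, h⟩) fun h => ⟨11, h⟩
    · exact ⟨10, diagPlane_equiv_of_cubic_cube he hd hD (by tauto)⟩
  · by_cases hroot : ∀ y z : F, y ≠ 0 ∨ z ≠ 0 →
        c * y ^ 3 + e * y ^ 2 * z + d * y * z ^ 2 + f * z ^ 3 ≠ 0
    · obtain ⟨p, q, s, t, ρ, hρ, hΔ, h1, h2, h3, h4⟩ := exists_moebius_of_irreducible hroot hσ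
      exact ⟨14, diagPlane_equiv_of_cubic_equiv he hd hD (by field_simp; grind)
        (by field_simp; grind) hρ hΔ h1 h2 h3 h4⟩
    · push Not at hroot
      obtain ⟨y, z, hyz, h⟩ := hroot
      exact (diagPlane_equiv_of_root hδ he hd hD hyz h).elim (fun h => ⟨12, h⟩) fun h => ⟨13, h⟩

theorem plane_equiv_alternating {Y₁ Z₁ p₁ q₁ r₁ Y₂ Z₂ p₂ q₂ r₂ : F}
    (hW : finrank F (plane Y₁ Z₁ p₁ q₁ r₁ Y₂ Z₂ p₂ q₂ r₂) = 3) (hD : Y₁ * Z₂ + Y₂ * Z₁ = 0) :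
    ∃ Y Z p q r p' q' r', CongruenceEquiv F (plane Y₁ Z₁ p₁ q₁ r₁ Y₂ Z₂ p₂ q₂ r₂)
      (plane Y Z p q r 0 0 p' q' r') := by
  by_cases hY : Y₂ = 0
  · by_cases hZ : Z₂ = 0
    · exact ⟨Y₁, Z₁, p₁, q₁, r₁, p₂, q₂, r₂, by rw [hY, hZ]; exact congruenceEquiv_refl _⟩
    · refine ⟨Y₂, Z₂, p₂, q₂, r₂, p₁ * Z₂ + p₂ * Z₁, q₁ * Z₂ + q₂ * Z₁, r₁ * Z₂ + r₂ * Z₁,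
        plane_equiv 1 0 0 1 0 0 1 hW one_ne_zero (by simp)
        (symMat_mem_plane.2 ⟨Z₁ / Z₂, 1 / Z₂, ?_⟩) (symMat_mem_plane.2 ⟨1, 0, by simp⟩)⟩
      refine ⟨?_, ?_, ?_, ?_, ?_⟩ <;> field_simp <;> grind
  · refine ⟨Y₂, Z₂, p₂, q₂, r₂, p₁ * Y₂ + p₂ * Y₁, q₁ * Y₂ + q₂ * Y₁, r₁ * Y₂ + r₂ * Y₁,
      plane_equiv 1 0 0 1 0 0 1 hW one_ne_zero (by simp)
      (symMat_mem_plane.2 ⟨Y₁ / Y₂, 1 / Y₂, ?_⟩) (symMat_mem_plane.2 ⟨1, 0, by simp⟩)⟩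
    refine ⟨?_, ?_, ?_, ?_, ?_⟩ <;> field_simp <;> grind

theorem plane_equiv_of_two_alternating {p₁ q₁ r₁ p₂ q₂ r₂ : F}
    (hW : finrank F (plane 0 0 p₁ q₁ r₁ 0 0 p₂ q₂ r₂) = 3) :
    CongruenceEquiv F (plane 0 0 p₁ q₁ r₁ 0 0 p₂ q₂ r₂) (plane 0 0 0 1 0 0 0 0 0 1) ∨
      CongruenceEquiv F (plane 0 0 p₁ q₁ r₁ 0 0 p₂ q₂ r₂) (plane 0 0 1 0 0 0 0 0 0 1) := by
  have hli := finrank_plane_eq_three_iff.1 hW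
  by_cases h2 : p₁ * r₂ + r₁ * p₂ = 0
  · by_cases h3 : p₁ * q₂ + q₁ * p₂ = 0
    · left
      have hp : p₁ = 0 ∧ p₂ = 0 := by
        have := hli p₂ p₁ (by simp) (by simp) (by grind) (by grind) (by grind)
        exact this.symm
      refine plane_equiv 1 0 0 1 0 0 1 hW one_ne_zero (by simp)
        (symMat_mem_plane.2 ⟨q₁, r₁, ?_⟩) (symMat_mem_plane.2 ⟨q₂, r₂, ?_⟩) <;> simp [hp]
    · right
      refine plane_equiv 1 0 ((q₁ * r₂ + r₁ * q₂) / (p₁ * q₂ + q₁ * p₂)) 0 1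
        (p₁ * q₂ + q₁ * p₂) (p₁ * r₂ + r₁ * p₂) hW one_ne_zero (by simpa using h3)
        (symMat_mem_plane.2 ⟨(p₁ * q₂ + q₁ * p₂) * p₁, q₁, ?_⟩)
        (symMat_mem_plane.2 ⟨(p₁ * q₂ + q₁ * p₂) * p₂, q₂, ?_⟩) <;> grind
  · right
    refine plane_equiv 1 ((q₁ * r₂ + r₁ * q₂) / (p₁ * r₂ + r₁ * p₂)) 0 1 0
      (p₁ * q₂ + q₁ * p₂) (p₁ * r₂ + r₁ * p₂) hW one_ne_zero (by simpa using h2)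
      (symMat_mem_plane.2 ⟨(p₁ * r₂ + r₁ * p₂) * p₁, r₁, ?_⟩)
      (symMat_mem_plane.2 ⟨(p₁ * r₂ + r₁ * p₂) * p₂, r₂, ?_⟩) <;> grind

theorem plane_equiv_of_one_alternating [Finite F] {Y Z p₁ q₁ r₁ P Q R : F}
    (hW : finrank F (plane Y Z p₁ q₁ r₁ 0 0 P Q R) = 3) (hYZ : Y ≠ 0 ∨ Z ≠ 0) :
    ∃ p q r p' q' r', CongruenceEquiv F (plane Y Z p₁ q₁ r₁ 0 0 P Q R)
      (plane 1 0 p q r 0 0 p' q' r') := by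
  by_cases hY : Y = 0
  · have hZ : Z ≠ 0 := by simpa [hY] using hYZ
    refine ⟨p₁ / Z, r₁ / Z, q₁ / Z, P, R, Q, plane_equiv 1 0 0 0 1 1 0 hW one_ne_zero (by simp)
      (symMat_mem_plane.2 ⟨Z, 0, ?_⟩) (symMat_mem_plane.2 ⟨0, 1, ?_⟩)⟩ <;> grind
  · obtain ⟨s, hs⟩ := exists_sq_eq (Z / Y)
    refine ⟨(s * Y + p₁) / Y, (q₁ + s * r₁) / Y, r₁ / Y, P, Q + s * R, R,
      plane_equiv 1 0 0 1 0 s 1 hW one_ne_zero (by simp)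
      (symMat_mem_plane.2 ⟨Y, 0, ?_⟩) (symMat_mem_plane.2 ⟨0, 1, ?_⟩)⟩ <;> grind

theorem plane_swap_equiv {F : Type} [Field F] :
    CongruenceEquiv F (plane 1 0 0 0 0 0 0 1 0 0) (plane 1 0 0 0 0 0 0 0 1 0) := by
  refine congruenceEquiv_of_forall_mem (A := !![0, 1, 0; 1, 0, 0; 0, 0, 1])
    (by simp [det_fin_three]) ((finrank_plane_le ..).trans_eq (Eq.symm ?_)) fun M hM => ?_
  · exact finrank_plane_eq_three_iff.2 (by simp +contextual)
  · obtain ⟨x, y, z, rfl⟩ := mem_plane.1 hM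
    refine mem_plane.2 ⟨y, x, z, ?_⟩
    ext i j
    fin_cases i <;> fin_cases j <;> simp [symMat, Matrix.mul_apply, Fin.sum_univ_three]

theorem plane_equiv_representative_of_one_alternating {p₁ q₁ r₁ P Q R : F} (δ σ : F)
    (hW : finrank F (plane 1 0 p₁ q₁ r₁ 0 0 P Q R) = 3) :
    ∃ i, CongruenceEquiv F (plane 1 0 p₁ q₁ r₁ 0 0 P Q R) (representative δ σ i) := by
  have hli := finrank_plane_eq_three_iff.1 hW
  by_cases hP : P = 0
  · subst hP
    by_cases hQ : Q = 0
    · subst hQ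
      by_cases hp : p₁ = 0
      · subst hp
        by_cases hq : q₁ = 0
        · refine ⟨2, plane_equiv 1 0 0 1 0 0 1 hW one_ne_zero (by simp)
            (symMat_mem_plane.2 ⟨1, r₁, ?_⟩) (symMat_mem_plane.2 ⟨0, R, ?_⟩)⟩ <;> simp [hq]
        · refine ⟨3, plane_equiv 1 0 0 1 0 0 (1 / q₁) hW one_ne_zero (by simpa using hq)
            (symMat_mem_plane.2 ⟨1, r₁, ?_⟩) (symMat_mem_plane.2 ⟨0, R, ?_⟩)⟩ <;> simp [hq]
      · refine ⟨4, plane_equiv 1 (q₁ / p₁) 0 1 0 0 (1 / p₁) hW one_ne_zero (by simpa using hp)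
            (symMat_mem_plane.2 ⟨1, q₁ / p₁ + r₁, ?_⟩) (symMat_mem_plane.2 ⟨0, R, ?_⟩)⟩ <;> grind
    · by_cases hp : p₁ = 0
      · subst hp
        refine ⟨5, plane_equiv 1 (r₁ + R / Q * q₁) 0 1 (R / Q) 0 1 hW one_ne_zero (by simp)
            (symMat_mem_plane.2 ⟨1, q₁, ?_⟩) (symMat_mem_plane.2 ⟨0, Q, ?_⟩)⟩ <;> grind
      · refine ⟨6, plane_equiv 1 0 ((r₁ + R / Q * q₁) / p₁) 1 (R / Q) 0 (1 / p₁) hW one_ne_zero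
            (by simpa using hp)
            (symMat_mem_plane.2 ⟨1, q₁ / p₁, ?_⟩) (symMat_mem_plane.2 ⟨0, Q / p₁, ?_⟩)⟩ <;> grind
  · obtain ⟨q, r, h⟩ : ∃ q r, CongruenceEquiv F (plane 1 0 p₁ q₁ r₁ 0 0 P Q R)
        (plane 1 0 0 q r 0 0 1 0 0) := by
      refine ⟨q₁ + Q / P * p₁, r₁ + Q / P + R / P * p₁,
        plane_equiv 1 (Q / P) (R / P) 1 0 0 1 hW one_ne_zero (by simp)
        (symMat_mem_plane.2 ⟨1, p₁, ?_⟩) (symMat_mem_plane.2 ⟨0, P, ?_⟩)⟩ <;> grind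
    have hW' : finrank F (plane 1 0 0 q r 0 0 1 0 0) = 3 :=
      (finrank_eq_of_congruenceEquiv h).symm.trans hW
    by_cases hq : q = 0
    · subst hq
      by_cases hr : r = 0
      · subst hr
        exact ⟨5, congruenceEquiv_trans h plane_swap_equiv⟩
      · refine ⟨7, congruenceEquiv_trans h (plane_equiv (1 / r) 0 0 1 0 0 1 hW' (by simpa using hr)
          (by simp) (symMat_mem_plane.2 ⟨1, 0, ?_⟩) (symMat_mem_plane.2 ⟨0, 1, ?_⟩))⟩ <;> simp [hr]
    · refine ⟨8, congruenceEquiv_trans h (plane_equiv 1 0 0 1 (r / q) 0 (1 / q) hW' one_ne_zero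
        (by simpa using hq) (symMat_mem_plane.2 ⟨1, 0, ?_⟩) (symMat_mem_plane.2 ⟨0, 1 / q, ?_⟩))⟩
      <;> grind

theorem exists_equiv_representative [Finite F] {δ σ : F}
    (hδ : ∀ c : F, ∃ m, m ^ 2 + m = c ∨ m ^ 2 + m = c + δ) (hσ0 : σ ≠ 0)
    (hσ : ∀ y z : F, y ≠ 0 ∨ z ≠ 0 →
      1 * y ^ 3 + 0 * y ^ 2 * z + 1 * y * z ^ 2 + σ * z ^ 3 ≠ 0)
    {W : Submodule F (Matrix (Fin 3) (Fin 3) F)} (hW : IsRankOnePlane F W) :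
    ∃ i, CongruenceEquiv F W (representative δ σ i) := by
  obtain ⟨Y₁, Z₁, p₁, q₁, r₁, Y₂, Z₂, p₂, q₂, r₂, hfin, h⟩ := exists_plane_of_isRankOnePlane hW
  suffices ∃ i, CongruenceEquiv F (plane Y₁ Z₁ p₁ q₁ r₁ Y₂ Z₂ p₂ q₂ r₂)
      (representative δ σ i) from this.imp fun _ hi => congruenceEquiv_trans h hi
  by_cases hD : Y₁ * Z₂ + Y₂ * Z₁ = 0
  · obtain ⟨Y, Z, p, q, r, p', q', r', h1⟩ := plane_equiv_alternating hfin hD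
    have hfin1 := (finrank_eq_of_congruenceEquiv h1).symm.trans hfin
    by_cases hYZ : Y = 0 ∧ Z = 0
    · obtain ⟨rfl, rfl⟩ := hYZ
      exact (plane_equiv_of_two_alternating hfin1).elim
        (fun h2 => ⟨0, congruenceEquiv_trans h1 h2⟩) fun h2 => ⟨1, congruenceEquiv_trans h1 h2⟩
    · obtain ⟨p₁, q₁, r₁, P, Q, R, h2⟩ := plane_equiv_of_one_alternating hfin1 (by tauto)
      have h3 := congruenceEquiv_trans h1 h2
      obtain ⟨i, hi⟩ := plane_equiv_representative_of_one_alternating δ σ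
        ((finrank_eq_of_congruenceEquiv h3).symm.trans hfin)
      exact ⟨i, congruenceEquiv_trans h3 hi⟩
  · obtain ⟨a, b, c, e, d, f, h1⟩ := plane_equiv_diagPlane hfin hD
    obtain ⟨i, hi⟩ := diagPlane_equiv_representative hδ hσ0 hσ a b c e d f
    exact ⟨i, congruenceEquiv_trans h1 hi⟩

/-! ### Congruence invariants -/

/-- The quadratic form of the matrix `N` vanishes identically. -/
def IsAlt (N : Matrix (Fin 3) (Fin 3) F) : Prop := ∀ v, v ⬝ᵥ N *ᵥ v = 0

theorem isAlt_symMat_iff {X Y Z p q r : F} :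
    IsAlt (symMat X Y Z p q r) ↔ X = 0 ∧ Y = 0 ∧ Z = 0 := by
  constructor
  · intro h
    refine ⟨?_, ?_, ?_⟩
    · simpa [symMat, dotProduct, mulVec, Fin.sum_univ_three] using h ![1, 0, 0]
    · simpa [symMat, dotProduct, mulVec, Fin.sum_univ_three] using h ![0, 1, 0]
    · simpa [symMat, dotProduct, mulVec, Fin.sum_univ_three] using h ![0, 0, 1]
  · rintro ⟨rfl, rfl, rfl⟩ v
    simp only [symMat, dotProduct, mulVec, Fin.sum_univ_three, of_apply, cons_val', cons_val_zero,
      cons_val_one, cons_val, cons_val_fin_one]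
    grind

theorem det_symMat (X Y Z p q r : F) :
    (symMat X Y Z p q r).det = X * Y * Z + X * p ^ 2 + Y * q ^ 2 + Z * r ^ 2 := by
  simp only [symMat, det_fin_three, of_apply, cons_val', cons_val_zero,
    cons_val_one, cons_val, cons_val_fin_one]
  grind

theorem exists_linearMap_of_congruenceEquiv {F : Type} [Field F]
    {W W' : Submodule F (Matrix (Fin 3) (Fin 3) F)}
    (h : CongruenceEquiv F W W') :
    ∃ (φ : Matrix (Fin 3) (Fin 3) F →ₗ[F] Matrix (Fin 3) (Fin 3) F) (k : F), k ≠ 0 ∧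
      (∀ M ∈ W, φ M ∈ W') ∧ (∀ M, φ M = 0 ↔ M = 0) ∧ (∀ M, (φ M).det = k * M.det) ∧
      (∀ M, (φ M).rank = M.rank) ∧ ∀ M, IsAlt M → IsAlt (φ M) := by
  obtain ⟨A, hA⟩ := h
  have hu : IsUnit A.val.det := (isUnit_iff_isUnit_det _).1 A.isUnit
  refine ⟨congruenceLin A.val, A.val.det ^ 2, pow_ne_zero 2 hu.ne_zero,
    fun M => mem_of_congruence hA, fun M => map_eq_zero_iff _ (congruence_injective hu.ne_zero),
    fun M => ?_, fun M => ?_, fun M hM v => ?_⟩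
  · rw [congruenceLin_apply, det_mul, det_mul, det_transpose]
    ring
  · rw [congruenceLin_apply, rank_mul_eq_left_of_isUnit_det _ _ (by rwa [det_transpose]),
      rank_mul_eq_right_of_isUnit_det _ _ hu]
  · rw [congruenceLin_apply, ← mulVec_mulVec, ← mulVec_mulVec, dotProduct_mulVec,
      ← mulVec_transpose]
    exact hM _

section Invariants

variable (W : Submodule F (Matrix (Fin 3) (Fin 3) F))

/-- `W` contains a nonzero alternating matrix. -/
def HasAlt : Prop := ∃ N ∈ W, IsAlt N ∧ N ≠ 0

/-- `W` contains two linearly independent alternating matrices. -/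
def HasTwoAlt : Prop := ∃ N ∈ W, ∃ N' ∈ W, IsAlt N ∧ IsAlt N' ∧ N ≠ 0 ∧ ∀ c : F, N' - c • N ≠ 0

/-- `W` contains an invertible matrix. -/
def HasInvertible : Prop := ∃ M ∈ W, M.det ≠ 0

/-- The determinant on `W` changes under translation by some alternating matrix. -/
def DetVariesAlongAlt : Prop := ∃ M ∈ W, ∃ N ∈ W, IsAlt N ∧ (M + N).det ≠ M.det

/-- Some sum of a rank-one and an alternating matrix of `W` is invertible. -/
def HasInvertibleRankOneAddAlt : Prop :=
  ∃ M ∈ W, ∃ N ∈ W, M.rank = 1 ∧ IsAlt N ∧ (M + N).det ≠ 0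

/-- Some sum of a rank-one and a nonzero alternating matrix of `W` is singular. -/
def HasSingularRankOneAddAlt : Prop :=
  ∃ M ∈ W, ∃ N ∈ W, M.rank = 1 ∧ IsAlt N ∧ N ≠ 0 ∧ (M + N).det = 0

/-- The determinant on `W` changes under translation by some rank-one matrix. -/
def DetVariesAlongRankOne : Prop := ∃ M ∈ W, ∃ N ∈ W, M.rank = 1 ∧ (M + N).det ≠ N.det

/-- `W` contains two linearly independent rank-one matrices. -/
def HasTwoRankOne : Prop :=
  ∃ M ∈ W, ∃ N ∈ W, M.rank = 1 ∧ N.rank = 1 ∧ ∀ c : F, N - c • M ≠ 0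

/-- Some sum of three rank-one matrices of `W` is invertible. -/
def HasInvertibleRankOneSum : Prop :=
  ∃ M ∈ W, ∃ N ∈ W, ∃ P ∈ W, M.rank = 1 ∧ N.rank = 1 ∧ P.rank = 1 ∧ (M + N + P).det ≠ 0

open Classical in
/-- A numerical congruence invariant built from the incidence properties above. -/
noncomputable def orbitCode : ℕ :=
  if HasAlt W then
    if HasTwoAlt W then if HasInvertible W then 1 else 0
    else if DetVariesAlongAlt W then
      if HasInvertibleRankOneAddAlt W then
        if HasSingularRankOneAddAlt W then 5 else if HasTwoRankOne W then 7 else 8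
      else 6
    else if HasInvertible W then if DetVariesAlongRankOne W then 4 else 3
    else 2
  else if HasTwoRankOne W then if HasInvertibleRankOneSum W then 9 else 10
  else 11

end Invariants

theorem orbitCode_eq_of_congruenceEquiv {F : Type} [Field F]
    {W W' : Submodule F (Matrix (Fin 3) (Fin 3) F)}
    (h : CongruenceEquiv F W W') : orbitCode W = orbitCode W' := by
  have lift (P : Submodule F (Matrix (Fin 3) (Fin 3) F) → Prop)
      (hP : ∀ V V', CongruenceEquiv F V V' → P V → P V') : P W ↔ P W' :=
    ⟨hP _ _ h, hP _ _ (congruenceEquiv_symm h)⟩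
  have h1 := lift HasAlt fun V V' h => by
    obtain ⟨φ, k, hk, hV, h0, hd, hr, ha⟩ := exists_linearMap_of_congruenceEquiv h
    rintro ⟨N, hN, h1, h2⟩
    exact ⟨φ N, hV _ hN, ha _ h1, (h0 N).not.2 h2⟩
  have h2 := lift HasTwoAlt fun V V' h => by
    obtain ⟨φ, k, hk, hV, h0, hd, hr, ha⟩ := exists_linearMap_of_congruenceEquiv h
    rintro ⟨N, hN, N', hN', h1, h2, h3, h4⟩
    refine ⟨φ N, hV _ hN, φ N', hV _ hN', ha _ h1, ha _ h2, (h0 N).not.2 h3, fun c => ?_⟩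
    rw [← map_smul, ← map_sub]
    exact (h0 _).not.2 (h4 c)
  have h3 := lift HasInvertible fun V V' h => by
    obtain ⟨φ, k, hk, hV, h0, hd, hr, ha⟩ := exists_linearMap_of_congruenceEquiv h
    rintro ⟨M, hM, h1⟩
    exact ⟨φ M, hV _ hM, by rw [hd]; exact mul_ne_zero hk h1⟩
  have h4 := lift DetVariesAlongAlt fun V V' h => by
    obtain ⟨φ, k, hk, hV, h0, hd, hr, ha⟩ := exists_linearMap_of_congruenceEquiv h
    rintro ⟨M, hM, N, hN, h1, h2⟩
    refine ⟨φ M, hV _ hM, φ N, hV _ hN, ha _ h1, ?_⟩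
    rw [← map_add, hd, hd]
    exact (mul_right_injective₀ hk).ne h2
  have h5 := lift HasInvertibleRankOneAddAlt fun V V' h => by
    obtain ⟨φ, k, hk, hV, h0, hd, hr, ha⟩ := exists_linearMap_of_congruenceEquiv h
    rintro ⟨M, hM, N, hN, h1, h2, h3⟩
    refine ⟨φ M, hV _ hM, φ N, hV _ hN, (hr M).trans h1, ha _ h2, ?_⟩
    rw [← map_add, hd]
    exact mul_ne_zero hk h3
  have h6 := lift HasSingularRankOneAddAlt fun V V' h => by
    obtain ⟨φ, k, hk, hV, h0, hd, hr, ha⟩ := exists_linearMap_of_congruenceEquiv h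
    rintro ⟨M, hM, N, hN, h1, h2, h3, h4⟩
    refine ⟨φ M, hV _ hM, φ N, hV _ hN, (hr M).trans h1, ha _ h2, (h0 N).not.2 h3, ?_⟩
    rw [← map_add, hd, h4, mul_zero]
  have h7 := lift DetVariesAlongRankOne fun V V' h => by
    obtain ⟨φ, k, hk, hV, h0, hd, hr, ha⟩ := exists_linearMap_of_congruenceEquiv h
    rintro ⟨M, hM, N, hN, h1, h2⟩
    refine ⟨φ M, hV _ hM, φ N, hV _ hN, (hr M).trans h1, ?_⟩
    rw [← map_add, hd, hd]
    exact (mul_right_injective₀ hk).ne h2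
  have h8 := lift HasTwoRankOne fun V V' h => by
    obtain ⟨φ, k, hk, hV, h0, hd, hr, ha⟩ := exists_linearMap_of_congruenceEquiv h
    rintro ⟨M, hM, N, hN, h1, h2, h3⟩
    refine ⟨φ M, hV _ hM, φ N, hV _ hN, (hr M).trans h1, (hr N).trans h2, fun c => ?_⟩
    rw [← map_smul, ← map_sub]
    exact (h0 _).not.2 (h3 c)
  have h9 := lift HasInvertibleRankOneSum fun V V' h => by
    obtain ⟨φ, k, hk, hV, h0, hd, hr, ha⟩ := exists_linearMap_of_congruenceEquiv h
    rintro ⟨M, hM, N, hN, P, hP, h1, h2, h3, h4⟩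
    refine ⟨φ M, hV _ hM, φ N, hV _ hN, φ P, hV _ hP, (hr M).trans h1, (hr N).trans h2,
      (hr P).trans h3, ?_⟩
    rw [← map_add, ← map_add, hd]
    exact mul_ne_zero hk h4
  grind [orbitCode]

/-! ### The invariant of each representative -/

theorem exists_mem_plane {F : Type} [Field F] {Y₁ Z₁ p₁ q₁ r₁ Y₂ Z₂ p₂ q₂ r₂ : F}
    {P : Matrix (Fin 3) (Fin 3) F → Prop} :
    (∃ M ∈ plane Y₁ Z₁ p₁ q₁ r₁ Y₂ Z₂ p₂ q₂ r₂, P M) ↔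
      ∃ x y z, P (symMat x (y * Y₁ + z * Y₂) (y * Z₁ + z * Z₂) (y * p₁ + z * p₂)
        (y * q₁ + z * q₂) (y * r₁ + z * r₂)) := by
  constructor
  · rintro ⟨M, hM, h⟩
    obtain ⟨x, y, z, rfl⟩ := mem_plane.1 hM
    exact ⟨x, y, z, h⟩
  · rintro ⟨x, y, z, h⟩
    exact ⟨_, mem_plane.2 ⟨x, y, z, rfl⟩, h⟩

theorem hasAlt_plane {Y Z p q r p' q' r' : F} (h : ¬(p' = 0 ∧ q' = 0 ∧ r' = 0)) :
    HasAlt (plane Y Z p q r 0 0 p' q' r') := by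
  refine exists_mem_plane.2 ⟨0, 0, 1, isAlt_symMat_iff.2 (by simp), ?_⟩
  simpa [symMat_eq_zero] using h

theorem not_hasAlt_diagPlane {a b c e d f : F} : ¬HasAlt (diagPlane a b c e d f) := by
  simp only [HasAlt, diagPlane, exists_mem_plane, isAlt_symMat_iff, ne_eq, symMat_eq_zero]
  rintro ⟨x, y, z, ⟨h1, h2, h3⟩, h4⟩
  simp at h2 h3
  simp [h1, h2, h3] at h4

theorem not_hasTwoAlt_plane {p q r p' q' r' : F} : ¬HasTwoAlt (plane 1 0 p q r 0 0 p' q' r') := by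
  simp only [HasTwoAlt, exists_mem_plane, isAlt_symMat_iff, ne_eq, symMat_eq_zero, smul_symMat,
    sub_eq_add_neg, ← neg_smul, symMat_add]
  rintro ⟨x, y, z, x', y', z', ⟨h1, h2, -⟩, ⟨h1', h2', -⟩, h3, h4⟩
  simp at h2 h2'
  subst h1 h2 h1' h2'
  have hz : z ≠ 0 := by rintro rfl; simp at h3
  refine h4 (z' / z) ?_
  refine ⟨?_, ?_, ?_, ?_, ?_, ?_⟩ <;> grind

theorem orbitCode_representative_zero (δ σ : F) : orbitCode (representative δ σ 0) = 0 := by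
  have h1 : HasAlt (representative δ σ 0) := hasAlt_plane (by simp)
  have h2 : HasTwoAlt (representative δ σ 0) := by
    simp only [HasTwoAlt, representative, cons_val, exists_mem_plane, isAlt_symMat_iff,
      ne_eq, symMat_eq_zero, smul_symMat, sub_eq_add_neg, ← neg_smul, symMat_add]
    exact ⟨0, 1, 0, 0, 0, 1, by simp⟩
  have h3 : ¬HasInvertible (representative δ σ 0) := by
    simp [HasInvertible, representative, exists_mem_plane, det_symMat]
  simp [orbitCode, h1, h2, h3]

theorem orbitCode_representative_one (δ σ : F) : orbitCode (representative δ σ 1) = 1 := by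
  have h1 : HasAlt (representative δ σ 1) := hasAlt_plane (by simp)
  have h2 : HasTwoAlt (representative δ σ 1) := by
    simp only [HasTwoAlt, representative, cons_val, exists_mem_plane, isAlt_symMat_iff,
      ne_eq, symMat_eq_zero, smul_symMat, sub_eq_add_neg, ← neg_smul, symMat_add]
    exact ⟨0, 1, 0, 0, 0, 1, by simp⟩
  have h3 : HasInvertible (representative δ σ 1) := by
    simp only [HasInvertible, representative, cons_val, exists_mem_plane, det_symMat]
    exact ⟨1, 1, 0, by simp⟩
  simp [orbitCode, h1, h2, h3]

theorem orbitCode_representative_two (δ σ : F) : orbitCode (representative δ σ 2) = 2 := by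
  have h1 : HasAlt (representative δ σ 2) := hasAlt_plane (by simp)
  have h2 : ¬HasTwoAlt (representative δ σ 2) := not_hasTwoAlt_plane
  have h3 : ¬DetVariesAlongAlt (representative δ σ 2) := by
    simp [DetVariesAlongAlt, representative, exists_mem_plane, det_symMat, symMat_add]
  have h4 : ¬HasInvertible (representative δ σ 2) := by
    simp [HasInvertible, representative, exists_mem_plane, det_symMat]
  simp [orbitCode, h1, h2, h3, h4]

theorem orbitCode_representative_three (δ σ : F) : orbitCode (representative δ σ 3) = 3 := by
  have h1 : HasAlt (representative δ σ 3) := hasAlt_plane (by simp)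
  have h2 : ¬HasTwoAlt (representative δ σ 3) := not_hasTwoAlt_plane
  have h3 : ¬DetVariesAlongAlt (representative δ σ 3) := by
    simp only [DetVariesAlongAlt, representative, cons_val, exists_mem_plane, det_symMat,
      symMat_add, isAlt_symMat_iff]
    rintro ⟨x, y, z, x', y', z', h, h'⟩
    grind
  have h4 : HasInvertible (representative δ σ 3) := by
    simp only [HasInvertible, representative, cons_val, exists_mem_plane, det_symMat]
    exact ⟨1, 1, 0, by simp⟩
  have h5 : ¬DetVariesAlongRankOne (representative δ σ 3) := by
    simp only [DetVariesAlongRankOne, representative, cons_val, exists_mem_plane, det_symMat,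
      symMat_add, rank_symMat_eq_one_iff]
    rintro ⟨x, y, z, x', y', z', h, h'⟩
    grind
  simp [orbitCode, h1, h2, h3, h4, h5]

theorem orbitCode_representative_four (δ σ : F) : orbitCode (representative δ σ 4) = 4 := by
  have h1 : HasAlt (representative δ σ 4) := hasAlt_plane (by simp)
  have h2 : ¬HasTwoAlt (representative δ σ 4) := not_hasTwoAlt_plane
  have h3 : ¬DetVariesAlongAlt (representative δ σ 4) := by
    simp only [DetVariesAlongAlt, representative, cons_val, exists_mem_plane, det_symMat,
      symMat_add, isAlt_symMat_iff]
    rintro ⟨x, y, z, x', y', z', h, h'⟩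
    grind
  have h4 : HasInvertible (representative δ σ 4) := by
    simp only [HasInvertible, representative, cons_val, exists_mem_plane, det_symMat]
    exact ⟨1, 1, 0, by simp⟩
  have h5 : DetVariesAlongRankOne (representative δ σ 4) := by
    simp only [DetVariesAlongRankOne, representative, cons_val, exists_mem_plane, det_symMat,
      symMat_add, rank_symMat_eq_one_iff, ne_eq, symMat_eq_zero]
    exact ⟨1, 0, 0, 0, 1, 0, by simp⟩
  simp [orbitCode, h1, h2, h3, h4, h5]

theorem orbitCode_representative_five (δ σ : F) : orbitCode (representative δ σ 5) = 5 := by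
  have h1 : HasAlt (representative δ σ 5) := hasAlt_plane (by simp)
  have h2 : ¬HasTwoAlt (representative δ σ 5) := not_hasTwoAlt_plane
  have h3 : DetVariesAlongAlt (representative δ σ 5) := by
    simp only [DetVariesAlongAlt, representative, cons_val, exists_mem_plane, det_symMat,
      symMat_add, isAlt_symMat_iff]
    exact ⟨0, 1, 0, 0, 0, 1, by simp⟩
  have h4 : HasInvertibleRankOneAddAlt (representative δ σ 5) := by
    simp only [HasInvertibleRankOneAddAlt, representative, cons_val, exists_mem_plane, det_symMat,
      symMat_add, rank_symMat_eq_one_iff, ne_eq, symMat_eq_zero, isAlt_symMat_iff]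
    exact ⟨0, 1, 0, 0, 0, 1, by simp⟩
  have h5 : HasSingularRankOneAddAlt (representative δ σ 5) := by
    simp only [HasSingularRankOneAddAlt, representative, cons_val, exists_mem_plane, det_symMat,
      symMat_add, rank_symMat_eq_one_iff, ne_eq, symMat_eq_zero, isAlt_symMat_iff]
    exact ⟨1, 0, 0, 0, 0, 1, by simp⟩
  simp [orbitCode, h1, h2, h3, h4, h5]

theorem orbitCode_representative_six (δ σ : F) : orbitCode (representative δ σ 6) = 6 := by
  have h1 : HasAlt (representative δ σ 6) := hasAlt_plane (by simp)
  have h2 : ¬HasTwoAlt (representative δ σ 6) := not_hasTwoAlt_plane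
  have h3 : DetVariesAlongAlt (representative δ σ 6) := by
    simp only [DetVariesAlongAlt, representative, cons_val, exists_mem_plane, det_symMat,
      symMat_add, isAlt_symMat_iff]
    exact ⟨0, 1, 0, 0, 0, 1, by simp⟩
  have h4 : ¬HasInvertibleRankOneAddAlt (representative δ σ 6) := by
    simp only [HasInvertibleRankOneAddAlt, representative, cons_val, exists_mem_plane, det_symMat,
      symMat_add, rank_symMat_eq_one_iff, isAlt_symMat_iff]
    rintro ⟨x, y, z, x', y', z', h, h', h''⟩
    grind
  simp [orbitCode, h1, h2, h3, h4]

theorem orbitCode_representative_seven (δ σ : F) : orbitCode (representative δ σ 7) = 7 := by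
  have h1 : HasAlt (representative δ σ 7) := hasAlt_plane (by simp)
  have h2 : ¬HasTwoAlt (representative δ σ 7) := not_hasTwoAlt_plane
  have h3 : DetVariesAlongAlt (representative δ σ 7) := by
    simp only [DetVariesAlongAlt, representative, cons_val, exists_mem_plane, det_symMat,
      symMat_add, isAlt_symMat_iff]
    exact ⟨1, 0, 0, 0, 0, 1, by simp⟩
  have h4 : HasInvertibleRankOneAddAlt (representative δ σ 7) := by
    simp only [HasInvertibleRankOneAddAlt, representative, cons_val, exists_mem_plane, det_symMat,
      symMat_add, rank_symMat_eq_one_iff, ne_eq, symMat_eq_zero, isAlt_symMat_iff]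
    exact ⟨1, 0, 0, 0, 0, 1, by simp⟩
  have h5 : ¬HasSingularRankOneAddAlt (representative δ σ 7) := by
    simp only [HasSingularRankOneAddAlt, representative, cons_val, exists_mem_plane, det_symMat,
      symMat_add, rank_symMat_eq_one_iff, ne_eq, symMat_eq_zero, isAlt_symMat_iff]
    rintro ⟨x, y, z, x', y', z', h, h', h'', h₃⟩
    grind
  have h6 : HasTwoRankOne (representative δ σ 7) := by
    simp only [HasTwoRankOne, representative, cons_val, exists_mem_plane, sub_eq_add_neg,
      ← neg_smul, smul_symMat, symMat_add, rank_symMat_eq_one_iff, ne_eq, symMat_eq_zero]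
    exact ⟨1, 0, 0, 1, 1, 0, by simp⟩
  simp [orbitCode, h1, h2, h3, h4, h5, h6]

theorem orbitCode_representative_eight (δ σ : F) : orbitCode (representative δ σ 8) = 8 := by
  have h1 : HasAlt (representative δ σ 8) := hasAlt_plane (by simp)
  have h2 : ¬HasTwoAlt (representative δ σ 8) := not_hasTwoAlt_plane
  have h3 : DetVariesAlongAlt (representative δ σ 8) := by
    simp only [DetVariesAlongAlt, representative, cons_val, exists_mem_plane, det_symMat,
      symMat_add, isAlt_symMat_iff]
    exact ⟨1, 0, 0, 0, 0, 1, by simp⟩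
  have h4 : HasInvertibleRankOneAddAlt (representative δ σ 8) := by
    simp only [HasInvertibleRankOneAddAlt, representative, cons_val, exists_mem_plane, det_symMat,
      symMat_add, rank_symMat_eq_one_iff, ne_eq, symMat_eq_zero, isAlt_symMat_iff]
    exact ⟨1, 0, 0, 0, 0, 1, by simp⟩
  have h5 : ¬HasSingularRankOneAddAlt (representative δ σ 8) := by
    simp only [HasSingularRankOneAddAlt, representative, cons_val, exists_mem_plane, det_symMat,
      symMat_add, rank_symMat_eq_one_iff, ne_eq, symMat_eq_zero, isAlt_symMat_iff]
    rintro ⟨x, y, z, x', y', z', h, h', h'', h₃⟩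
    grind
  have h6 : ¬HasTwoRankOne (representative δ σ 8) := by
    simp only [HasTwoRankOne, representative, cons_val, exists_mem_plane, sub_eq_add_neg,
      ← neg_smul, smul_symMat, symMat_add, rank_symMat_eq_one_iff, ne_eq, symMat_eq_zero]
    rintro ⟨x, y, z, x', y', z', h, h', h''⟩
    have := h'' (x' / x)
    grind
  simp [orbitCode, h1, h2, h3, h4, h5, h6]

theorem orbitCode_representative_nine (δ σ : F) : orbitCode (representative δ σ 9) = 9 := by
  have h1 : ¬HasAlt (representative δ σ 9) := not_hasAlt_diagPlane
  have h2 : HasTwoRankOne (representative δ σ 9) := by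
    simp only [HasTwoRankOne, representative, diagPlane, cons_val, exists_mem_plane, sub_eq_add_neg,
      ← neg_smul, smul_symMat, symMat_add, rank_symMat_eq_one_iff, ne_eq, symMat_eq_zero]
    exact ⟨1, 0, 0, 0, 1, 0, by simp⟩
  have h3 : HasInvertibleRankOneSum (representative δ σ 9) := by
    simp only [HasInvertibleRankOneSum, representative, diagPlane, cons_val, exists_mem_plane,
      symMat_add, rank_symMat_eq_one_iff, ne_eq, symMat_eq_zero, det_symMat]
    exact ⟨1, 0, 0, 0, 1, 0, 0, 0, 1, by simp⟩
  simp [orbitCode, h1, h2, h3]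

theorem orbitCode_representative_ten (δ σ : F) : orbitCode (representative δ σ 10) = 10 := by
  have h1 : ¬HasAlt (representative δ σ 10) := not_hasAlt_diagPlane
  have h2 : HasTwoRankOne (representative δ σ 10) := by
    simp only [HasTwoRankOne, representative, diagPlane, cons_val, exists_mem_plane, sub_eq_add_neg,
      ← neg_smul, smul_symMat, symMat_add, rank_symMat_eq_one_iff, ne_eq, symMat_eq_zero]
    exact ⟨1, 0, 0, 0, 0, 1, by simp⟩
  have h3 : ¬HasInvertibleRankOneSum (representative δ σ 10) := by
    simp only [HasInvertibleRankOneSum, representative, diagPlane, cons_val, exists_mem_plane,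
      symMat_add, rank_symMat_eq_one_iff, det_symMat]
    rintro ⟨x, y, z, x', y', z', x'', y'', z'', ⟨-, h⟩, ⟨-, h'⟩, ⟨-, h''⟩, hne⟩
    have e : y = 0 := by grind
    have e' : y' = 0 := by grind
    have e'' : y'' = 0 := by grind
    simp [e, e', e''] at hne
  simp [orbitCode, h1, h2, h3]
/-- Every rank-one matrix of `W` is a multiple of `E₁₁`. -/
def HasUniqueRankOne (W : Submodule F (Matrix (Fin 3) (Fin 3) F)) : Prop :=
  ∀ M ∈ W, M.rank = 1 → ∃ x, M = symMat x 0 0 0 0 0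

theorem hasUniqueRankOne_diagPlane {a b c e d f : F}
    (h : ∀ y z, y * z = (y * a + z * b) ^ 2 →
      y * (y * c + z * d) = (y * a + z * b) * (y * e + z * f) →
      z * (y * e + z * f) = (y * a + z * b) * (y * c + z * d) → y = 0 ∧ z = 0) :
    HasUniqueRankOne (diagPlane a b c e d f) := by
  intro M hM hr
  obtain ⟨x, y, z, rfl⟩ := mem_plane.1 hM
  obtain ⟨-, h1, -, -, -, h2, h3⟩ := rank_symMat_eq_one_iff.1 hr
  obtain ⟨rfl, rfl⟩ := h y z (by simpa using h1) (by simpa using h2) (by simpa using h3)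
  exact ⟨x, by simp⟩

theorem hasUniqueRankOne_representative {δ σ : F} (hδ : ∀ m : F, m ^ 2 + m ≠ δ) (hσ : σ ≠ 0)
    {i : Fin 15} (hi : 11 ≤ i) : HasUniqueRankOne (representative δ σ i) := by
  obtain rfl | rfl | rfl | rfl : i = 11 ∨ i = 12 ∨ i = 13 ∨ i = 14 := by omega
  · refine hasUniqueRankOne_diagPlane fun y z h1 _ _ => ?_
    have hz : z = 0 := by
      by_contra hz
      refine hδ (y / z + δ) ?_
      field_simp
      grind
    subst hz
    exact ⟨by simpa using h1.symm, rfl⟩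
  · exact hasUniqueRankOne_diagPlane fun y z h1 h2 h3 => ⟨by grind, by grind⟩
  · exact hasUniqueRankOne_diagPlane fun y z h1 h2 h3 => ⟨by grind, by grind⟩
  · refine hasUniqueRankOne_diagPlane fun y z h1 h2 h3 => ?_
    have : σ * σ⁻¹ = 1 := mul_inv_cancel₀ hσ
    have hy : y = z := by grind
    subst hy
    have : σ * y ^ 2 = 0 := by grind
    have : y = 0 := by simpa [hσ] using this
    exact ⟨this, this⟩

theorem not_hasTwoRankOne {W : Submodule F (Matrix (Fin 3) (Fin 3) F)} (h : HasUniqueRankOne W) :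
    ¬HasTwoRankOne W := by
  rintro ⟨M, hM, N, hN, hMr, hNr, hne⟩
  obtain ⟨x, rfl⟩ := h M hM hMr
  obtain ⟨y, rfl⟩ := h N hN hNr
  have hx : x ≠ 0 := by simpa [symMat_eq_zero] using (rank_symMat_eq_one_iff.1 hMr).1
  refine hne (y / x) ?_
  rw [smul_symMat, div_mul_cancel₀ y hx]
  simp

theorem orbitCode_representative_of_ge {δ σ : F} (hδ : ∀ m : F, m ^ 2 + m ≠ δ) (hσ : σ ≠ 0)
    {i : Fin 15} (hi : 11 ≤ i) : orbitCode (representative δ σ i) = 11 := by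
  have h1 : ¬HasAlt (representative δ σ i) := by
    obtain rfl | rfl | rfl | rfl : i = 11 ∨ i = 12 ∨ i = 13 ∨ i = 14 := by omega
    all_goals exact not_hasAlt_diagPlane
  have h2 := not_hasTwoRankOne (hasUniqueRankOne_representative hδ hσ hi)
  simp [orbitCode, h1, h2]

/-! ### Planes with a single rank-one point and no alternating matrix -/

theorem exists_cubic_equiv_of_diagPlane_equiv {a b c e d f a' b' c' e' d' f' : F}
    (hu : HasUniqueRankOne (diagPlane a' b' c' e' d' f'))
    (he : e = a * d + b * c) (hd : d = a * f + b * e)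
    (he' : e' = a' * d' + b' * c') (hd' : d' = a' * f' + b' * e')
    (h : CongruenceEquiv F (diagPlane a b c e d f) (diagPlane a' b' c' e' d' f')) :
    ∃ p q s t ρ, ρ ≠ 0 ∧ p * t + q * s ≠ 0 ∧
      ρ * c = c' * p ^ 3 + e' * p ^ 2 * s + d' * p * s ^ 2 + f' * s ^ 3 ∧
      ρ * e = p ^ 2 * (c' * q + e' * t) + s ^ 2 * (d' * q + f' * t) ∧
      ρ * d = q ^ 2 * (c' * p + e' * s) + t ^ 2 * (d' * p + f' * s) ∧
      ρ * f = c' * q ^ 3 + e' * q ^ 2 * t + d' * q * t ^ 2 + f' * t ^ 3 := by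
  obtain ⟨A, hA⟩ := h
  have hdet : A.val.det ≠ 0 := ((isUnit_iff_isUnit_det _).1 A.isUnit).ne_zero
  have hcol : A.val 1 0 = 0 ∧ A.val 2 0 = 0 := by
    have hm := mem_of_congruence hA (symMat_one_mem_plane (F := F))
    have hr : (A.val * symMat 1 0 0 0 0 0 * A.valᵀ).rank = 1 := by
      rw [rank_mul_eq_left_of_isUnit_det _ _ (by rw [det_transpose]; exact hdet.isUnit),
        rank_mul_eq_right_of_isUnit_det _ _ hdet.isUnit, rank_symMat_one]
    obtain ⟨x, hx⟩ := hu _ hm hr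
    have h1 := congrFun (congrFun hx 1) 1
    have h2 := congrFun (congrFun hx 2) 2
    simp [symMat, Matrix.mul_apply, Fin.sum_univ_three] at h1 h2
    exact ⟨h1, h2⟩
  obtain ⟨κ, l, m, p, q, s, t, hB⟩ : ∃ κ l m p q s t, A.val = !![κ, l, m; 0, p, q; 0, s, t] := by
    refine ⟨A.val 0 0, A.val 0 1, A.val 0 2, A.val 1 1, A.val 1 2, A.val 2 1, A.val 2 2, ?_⟩
    ext i j
    fin_cases i <;> fin_cases j <;> simp [hcol]
  have hκΔ : κ * (p * t + q * s) ≠ 0 := by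
    convert hdet using 1
    rw [hB, det_fin_three]
    simp
    grind
  have hκ : κ ≠ 0 := left_ne_zero_of_mul hκΔ
  have hΔ : p * t + q * s ≠ 0 := right_ne_zero_of_mul hκΔ
  have g1 := mem_of_congruence hA (M := symMat 0 1 0 a c e)
    (symMat_mem_plane.2 ⟨1, 0, by simp⟩)
  have g2 := mem_of_congruence hA (M := symMat 0 0 1 b d f)
    (symMat_mem_plane.2 ⟨0, 1, by simp⟩)
  rw [hB, congruence_symMat] at g1 g2
  obtain ⟨y, z, a1, a2, h1, h5, h3⟩ := symMat_mem_plane.1 g1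
  obtain ⟨y', z', b1, b2, h2, h6, h4⟩ := symMat_mem_plane.1 g2
  obtain rfl : p ^ 2 = y := by linear_combination a1
  obtain rfl : s ^ 2 = z := by linear_combination a2
  obtain rfl : q ^ 2 = y' := by linear_combination b1
  obtain rfl : t ^ 2 = z' := by linear_combination b2
  clear a1 a2 b1 b2 g1 g2 hB hcol hA hdet hu
  generalize hΔ' : p * t + q * s = Δ at *
  have k1 : Δ * (κ * c + l * a) = c' * p ^ 3 + e' * p ^ 2 * s + d' * p * s ^ 2 + f' * s ^ 3 := by
    linear_combination (norm := skip) p * h5 + s * h3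
    grind
  have k2 : Δ * (κ * e + l + m * a) =
      p ^ 2 * (c' * q + e' * t) + s ^ 2 * (d' * q + f' * t) := by
    linear_combination (norm := skip) q * h5 + t * h3
    grind
  have k3 : Δ * (κ * d + m + l * b) =
      q ^ 2 * (c' * p + e' * s) + t ^ 2 * (d' * p + f' * s) := by
    linear_combination (norm := skip) p * h6 + s * h4
    grind
  have k4 : Δ * (κ * f + m * b) =
      c' * q ^ 3 + e' * q ^ 2 * t + d' * q * t ^ 2 + f' * t ^ 3 := by
    linear_combination (norm := skip) q * h6 + t * h4
    grind
  clear h3 h4 h5 h6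
  have e1 : Δ * a = a' * p ^ 2 + b' * s ^ 2 + p * s := by grind
  have e2 : Δ * b = a' * q ^ 2 + b' * t ^ 2 + q * t := by grind
  have hl : l = 0 := by
    have : Δ * (Δ * (κ * e + l + m * a)) =
        Δ * a * (Δ * (κ * d + m + l * b)) + Δ * b * (Δ * (κ * c + l * a)) := by
      rw [k1, k2, k3, e1, e2, ← hΔ']
      clear * - he' hd'
      linear_combination (norm := skip)
        (p * t + q * s) ^ 2 * p * he' + (p * t + q * s) ^ 2 * s * hd'
      grind
    have : Δ ^ 2 * l = 0 := by
      linear_combination (norm := skip) this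
      grind
    simpa [hΔ] using this
  have hm : m = 0 := by
    have : Δ * (Δ * (κ * d + m + l * b)) =
        Δ * a * (Δ * (κ * f + m * b)) + Δ * b * (Δ * (κ * e + l + m * a)) := by
      rw [k2, k3, k4, e1, e2, ← hΔ']
      clear * - he' hd'
      linear_combination (norm := skip)
        (p * t + q * s) ^ 2 * q * he' + (p * t + q * s) ^ 2 * t * hd'
      grind
    have : Δ ^ 2 * m = 0 := by
      linear_combination (norm := skip) this
      grind
    simpa [hΔ] using this
  subst hl hm
  refine ⟨p, q, s, t, Δ * κ, mul_ne_zero hΔ hκ, hΔ'.symm ▸ hΔ, ?_, ?_, ?_, ?_⟩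
  · linear_combination k1
  · linear_combination k2
  · linear_combination k3
  · linear_combination k4

/-! ### The representatives are pairwise inequivalent -/

section Separation

variable {δ σ : F}

theorem not_congruenceEquiv_representative_eleven (hδ : ∀ m : F, m ^ 2 + m ≠ δ) (hσ : σ ≠ 0)
    {i : Fin 15} (hi : 11 < i) :
    ¬CongruenceEquiv F (representative δ σ i) (representative δ σ 11) := by
  have hu := hasUniqueRankOne_representative hδ hσ (i := 11) le_rfl
  intro h
  obtain rfl | rfl | rfl : i = 12 ∨ i = 13 ∨ i = 14 := by omega
  · obtain ⟨p, q, s, t, ρ, hρ, hΔ, h1, h2, h3, h4⟩ := exists_cubic_equiv_of_diagPlane_equiv hu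
      (by grind) (by grind) (by grind) (by grind) h
    exact hρ (by linear_combination h2)
  · obtain ⟨p, q, s, t, ρ, hρ, hΔ, h1, h2, h3, h4⟩ := exists_cubic_equiv_of_diagPlane_equiv hu
      (by grind) (by grind) (by grind) (by grind) h
    exact hρ (by linear_combination h2)
  · obtain ⟨p, q, s, t, ρ, hρ, hΔ, h1, h2, h3, h4⟩ := exists_cubic_equiv_of_diagPlane_equiv hu
      (by grind) (by grind) (by grind) (by grind) h
    exact hρ (by linear_combination h1)

theorem not_congruenceEquiv_representative_fourteen (hδ : ∀ m : F, m ^ 2 + m ≠ δ) (hσ0 : σ ≠ 0)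
    (hσ : ∀ y z : F, y ≠ 0 ∨ z ≠ 0 →
      1 * y ^ 3 + 0 * y ^ 2 * z + 1 * y * z ^ 2 + σ * z ^ 3 ≠ 0)
    {i : Fin 15} (hi : i = 12 ∨ i = 13) :
    ¬CongruenceEquiv F (representative δ σ i) (representative δ σ 14) := by
  have hu := hasUniqueRankOne_representative hδ hσ0 (i := 14) (by decide)
  intro h
  have key {p q s t : F} (hΔ : p * t + q * s ≠ 0) : q ≠ 0 ∨ t ≠ 0 := by
    by_contra! hqt
    simp [hqt] at hΔ
  obtain rfl | rfl := hi
  · obtain ⟨p, q, s, t, ρ, hρ, hΔ, h1, h2, h3, h4⟩ := exists_cubic_equiv_of_diagPlane_equiv hu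
      (by grind) (by grind) (by grind) (by grind) h
    exact hσ q t (key hΔ) (by linear_combination -h4)
  · obtain ⟨p, q, s, t, ρ, hρ, hΔ, h1, h2, h3, h4⟩ := exists_cubic_equiv_of_diagPlane_equiv hu
      (by grind) (by grind) (by grind) (by grind) h
    exact hσ q t (key hΔ) (by linear_combination -h4)

theorem not_congruenceEquiv_representative_twelve_thirteen (hδ : ∀ m : F, m ^ 2 + m ≠ δ)
    (hσ : σ ≠ 0) : ¬CongruenceEquiv F (representative δ σ 12) (representative δ σ 13) := by
  have hu := hasUniqueRankOne_representative hδ hσ (i := 13) (by decide)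
  intro h
  obtain ⟨p, q, s, t, ρ, hρ, hΔ, h1, h2, h3, h4⟩ := exists_cubic_equiv_of_diagPlane_equiv hu
    (by grind) (by grind) (by grind) (by grind) h
  have key {y z : F} (h : δ * y ^ 3 + y ^ 2 * z + y * z ^ 2 = 0) : y = 0 := by
    by_contra hy
    refine hδ (z / y) ?_
    field_simp
    have : y * (δ * y ^ 2 + y * z + z ^ 2) = 0 := by linear_combination h
    have := (mul_eq_zero.1 this).resolve_left hy
    grind
  have hp : p = 0 := key (z := s) (by linear_combination -h1)
  have hq : q = 0 := key (z := t) (by linear_combination -h4)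
  simp [hp, hq] at hΔ

theorem orbitCode_representative (hδ : ∀ m : F, m ^ 2 + m ≠ δ) (hσ : σ ≠ 0) (i : Fin 15) :
    orbitCode (representative δ σ i) = min i.val 11 := by
  by_cases hi : 11 ≤ i
  · rw [orbitCode_representative_of_ge hδ hσ hi]
    omega
  fin_cases i
  · exact orbitCode_representative_zero δ σ
  · exact orbitCode_representative_one δ σ
  · exact orbitCode_representative_two δ σ
  · exact orbitCode_representative_three δ σ
  · exact orbitCode_representative_four δ σ
  · exact orbitCode_representative_five δ σ
  · exact orbitCode_representative_six δ σ
  · exact orbitCode_representative_seven δ σ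
  · exact orbitCode_representative_eight δ σ
  · exact orbitCode_representative_nine δ σ
  · exact orbitCode_representative_ten δ σ
  all_goals exact absurd (by decide) hi

theorem eq_of_congruenceEquiv_representative (hδ : ∀ m : F, m ^ 2 + m ≠ δ) (hσ0 : σ ≠ 0)
    (hσ : ∀ y z : F, y ≠ 0 ∨ z ≠ 0 →
      1 * y ^ 3 + 0 * y ^ 2 * z + 1 * y * z ^ 2 + σ * z ^ 3 ≠ 0)
    {i j : Fin 15} (h : CongruenceEquiv F (representative δ σ i) (representative δ σ j)) :
    i = j := by
  wlog hij : i ≤ j generalizing i j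
  · exact (this (congruenceEquiv_symm h) (le_of_not_ge hij)).symm
  have hc := orbitCode_eq_of_congruenceEquiv h
  rw [orbitCode_representative hδ hσ0, orbitCode_representative hδ hσ0] at hc
  by_contra hne
  have h1 : ¬(i = 11 ∧ 11 < j) := by
    rintro ⟨rfl, hj⟩
    exact not_congruenceEquiv_representative_eleven hδ hσ0 hj (congruenceEquiv_symm h)
  have h2 : ¬((i = 12 ∨ i = 13) ∧ j = 14) := by
    rintro ⟨hi, rfl⟩
    exact not_congruenceEquiv_representative_fourteen hδ hσ0 hσ hi h
  have h3 : ¬(i = 12 ∧ j = 13) := by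
    rintro ⟨rfl, rfl⟩
    exact not_congruenceEquiv_representative_twelve_thirteen hδ hσ0 h
  omega

theorem isRankOnePlane_representative {F : Type} [Field F] (δ σ : F) (i : Fin 15) :
    IsRankOnePlane F (representative δ σ i) := by
  fin_cases i <;> exact isRankOnePlane_plane (by simp +contextual)

end Separation

end NormalForms

end VeronesePlanes

/-- For `q = 2^h` even, there are exactly `15` orbits of planes of `PG(5,q)` meeting the
Veronese surface in at least one point, under the congruence action of `GL(3,q)` on the
3-dimensional subspaces of `Sym₃(F_q)`. -/
theorem fifteen_orbits_of_planes_meeting_veronese (h : ℕ) (hh : 0 < h)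
    (F : Type) [Field F] [Fintype F] (hF : Fintype.card F = 2 ^ h) :
    ∃ f : {W : Submodule F (Matrix (Fin 3) (Fin 3) F) // IsRankOnePlane F W} → Fin 15,
      Function.Surjective f ∧
      ∀ W₁ W₂, (f W₁ = f W₂ ↔ CongruenceEquiv F W₁.val W₂.val) := by
  have : CharP F 2 := charP_of_card_eq_prime_pow hF
  obtain ⟨δ, hδ, hδ'⟩ := VeronesePlanes.exists_artin_schreier_parameter F
  obtain ⟨σ, hσ0, hσ⟩ := VeronesePlanes.exists_cubic_parameter F
  choose f hf using fun W : {W : Submodule F (Matrix (Fin 3) (Fin 3) F) // IsRankOnePlane F W} =>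
    VeronesePlanes.exists_equiv_representative hδ' hσ0 hσ W.2
  refine ⟨f, fun i => ?_, fun W₁ W₂ => ⟨fun h => ?_, fun h => ?_⟩⟩
  · refine ⟨⟨_, VeronesePlanes.isRankOnePlane_representative δ σ i⟩, ?_⟩
    exact (VeronesePlanes.eq_of_congruenceEquiv_representative hδ hσ0 hσ (hf ⟨_, _⟩)).symm
  · exact VeronesePlanes.congruenceEquiv_trans (hf W₁)
      (VeronesePlanes.congruenceEquiv_symm (h ▸ hf W₂))
  · exact VeronesePlanes.eq_of_congruenceEquiv_representative hδ hσ0 hσ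
      (VeronesePlanes.congruenceEquiv_trans (VeronesePlanes.congruenceEquiv_symm (hf W₁))
        (VeronesePlanes.congruenceEquiv_trans h (hf W₂)))
end

section
/- Let q = 2^h be a power of 2 and F a finite field with q elements. There is no 3-dimensional F-linear subspace W of Sym₃(F) such that W contains exactly one 1-dimensional subspace spanned by a rank-1 matrix and contains no rank-2 matrix (equivalently, no plane of PG(5,q) has rank distribution [1, 0, q²+q]). -/
open Matrix

/-- A *point* of a plane `W` of `PG(5,q)` (viewed as a 3-dimensional linear subspace of the
space of symmetric `3×3` matrices): a 1-dimensional linear subspace `P ≤ W`, all of whose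
nonzero matrices satisfy the predicate `pred` (e.g. a rank condition). -/
def IsPointOf (F : Type) [Field F] (W P : Submodule F (Matrix (Fin 3) (Fin 3) F))
    (pred : Matrix (Fin 3) (Fin 3) F → Prop) : Prop :=
  P ≤ W ∧ Module.finrank F ↥P = 1 ∧ ∀ M ∈ P, M ≠ 0 → pred M

/-- A nonzero vector is carried to the first standard basis vector by some invertible matrix. -/
theorem exists_det_ne_zero_mulVec_eq_single {F : Type*} [Field F] {n : ℕ} {v : Fin (n + 1) → F}
    (hv : v ≠ 0) :
    ∃ Q : Matrix (Fin (n + 1)) (Fin (n + 1)) F, Q.det ≠ 0 ∧ Q *ᵥ v = Pi.single 0 1 := by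
  have he : (Pi.single 0 1 : Fin (n + 1) → F) ≠ 0 := by simp
  let f := (LinearEquiv.toSpanNonzeroSingleton F _ v hv).symm.trans
    (LinearEquiv.toSpanNonzeroSingleton F _ _ he)
  obtain ⟨g, hg⟩ := Submodule.exists_linearEquiv_restrict_eq f
  refine ⟨LinearMap.toMatrix' g.toLinearMap, ?_, ?_⟩
  · rw [LinearMap.det_toMatrix']
    exact g.isUnit_det'.ne_zero
  · rw [LinearMap.toMatrix'_mulVec]
    have h1 := hg ⟨v, Submodule.mem_span_singleton_self v⟩
    rw [LinearEquiv.coe_coe, ← h1]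
    have h2 : (LinearEquiv.toSpanNonzeroSingleton F _ v hv).symm
        ⟨v, Submodule.mem_span_singleton_self v⟩ = 1 := by
      rw [LinearEquiv.symm_apply_eq, LinearEquiv.toSpanNonzeroSingleton_one]
    simp only [f, LinearEquiv.trans_apply, h2]
    simp

/-- A matrix of rank one is an outer product of two nonzero vectors. -/
theorem exists_eq_vecMulVec_of_rank_eq_one {F m n : Type*} [Field F] [Fintype m] [Fintype n]
    {R : Matrix m n F} (hR : R.rank = 1) :
    ∃ w v, w ≠ 0 ∧ v ≠ 0 ∧ R = vecMulVec w v := by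
  classical
  obtain ⟨⟨w, hw⟩, -, hspan⟩ := finrank_eq_one_iff'.1 hR
  have hcol : ∀ j, ∃ c : F, c • w = R.col j := fun j => by
    obtain ⟨c, hc⟩ := hspan ⟨R.col j, Pi.single j 1, by simp⟩
    exact ⟨c, congrArg Subtype.val hc⟩
  choose v hv using hcol
  have hRwv : R = vecMulVec w v := by
    ext i j
    have := congrFun (hv j) i
    simp only [Pi.smul_apply, smul_eq_mul, col_apply] at this
    rw [vecMulVec_apply, ← this, mul_comm]
  have hR0 : R ≠ 0 := by
    rintro rfl
    simp at hR
  refine ⟨w, v, ?_, ?_, hRwv⟩ <;> rintro rfl <;>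
    exact hR0 (by rw [hRwv]; ext; simp [vecMulVec_apply])

/-- A symmetric matrix of rank one is congruent to a nonzero multiple of a diagonal matrix unit. -/
theorem exists_congruent_single_of_rank_eq_one {F : Type*} [Field F] {n : ℕ}
    {R : Matrix (Fin (n + 1)) (Fin (n + 1)) F} (hsymm : R.IsSymm) (hR : R.rank = 1) :
    ∃ (Q : Matrix (Fin (n + 1)) (Fin (n + 1)) F) (s : F),
      Q.det ≠ 0 ∧ s ≠ 0 ∧ Q * R * Qᵀ = Matrix.single 0 0 s := by
  obtain ⟨w, v, hw, hv, rfl⟩ := exists_eq_vecMulVec_of_rank_eq_one hR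
  obtain ⟨Q, hQ, hQv⟩ := exists_det_ne_zero_mulVec_eq_single hv
  have hprod : Q * vecMulVec w v * Qᵀ = vecMulVec (Q *ᵥ w) (Pi.single 0 1) := by
    rw [mul_vecMulVec, vecMulVec_mul, vecMul_transpose, hQv]
  have hzero : ∀ i, i ≠ 0 → (Q *ᵥ w) i = 0 := fun i hi => by
    have hs : (Q * vecMulVec w v * Qᵀ).IsSymm := by
      rw [Matrix.IsSymm, transpose_mul, transpose_mul, transpose_transpose, hsymm.eq, mul_assoc]
    have := hs.apply i 0
    rw [hprod] at this
    simpa [vecMulVec_apply, hi] using this.symm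
  have hQw : Q *ᵥ w = Pi.single 0 ((Q *ᵥ w) 0) := by
    ext i
    by_cases hi : i = 0
    · subst hi; simp
    · simp [hi, hzero i hi]
  refine ⟨Q, (Q *ᵥ w) 0, hQ, fun h0 => hw ?_, ?_⟩
  · rw [h0, Pi.single_zero] at hQw
    exact eq_zero_of_mulVec_eq_zero hQ hQw
  · rw [hprod, hQw]
    ext i j
    by_cases hi : i = 0 <;> by_cases hj : j = 0 <;>
      simp [vecMulVec_apply, hi, hj, eq_comm]

/-- Let `W` be a space of symmetric `3 × 3` matrices in which every singular matrix is a multiple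
of a fixed rank-one matrix `R ∈ W`. Then `W` is spanned by `R` and one further matrix. -/
theorem finrank_le_two_of_singular_mem_span {F : Type*} [Field F]
    (W : Submodule F (Matrix (Fin 3) (Fin 3) F)) (hsymm : ∀ M ∈ W, M.IsSymm)
    {R : Matrix (Fin 3) (Fin 3) F} (hRW : R ∈ W) (hR : R.rank = 1)
    (hsing : ∀ M ∈ W, M.det = 0 → ∃ c : F, M = c • R) :
    Module.finrank F W ≤ 2 := by
  obtain ⟨Q, s, hQ, hs, hQR⟩ := exists_congruent_single_of_rank_eq_one (hsymm R hRW) hR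
  let φ : Matrix (Fin 3) (Fin 3) F →ₗ[F] Matrix (Fin 3) (Fin 3) F :=
    { toFun := fun M => Q * M * Qᵀ
      map_add' := fun M N => by rw [mul_add, add_mul]
      map_smul' := fun c M => by simp }
  have hφR : φ R = Matrix.single 0 0 s := hQR
  have hdet : ∀ M, (φ M).det = 0 → M.det = 0 := fun M hM => by
    have : Q.det * M.det * Q.det = 0 := by simpa [φ, det_mul] using hM
    simpa [hQ] using this
  have hφsymm : ∀ M ∈ W, ∀ i j, φ M i j = φ M j i := fun M hM i j => by
    have : (φ M).IsSymm := by
      change (Q * M * Qᵀ)ᵀ = Q * M * Qᵀ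
      rw [transpose_mul, transpose_mul, transpose_transpose, (hsymm M hM).eq, mul_assoc]
    exact this.apply j i
  have hminor : ∀ M ∈ W, φ M 1 1 * φ M 2 2 = φ M 1 2 ^ 2 := fun M hM => by
    by_contra hne
    have hD : φ M 1 1 * φ M 2 2 - φ M 1 2 ^ 2 ≠ 0 := sub_ne_zero.2 hne
    let t : F := -(φ M).det / (s * (φ M 1 1 * φ M 2 2 - φ M 1 2 ^ 2))
    have ht : t * s * (φ M 1 1 * φ M 2 2 - φ M 1 2 ^ 2) = -(φ M).det := by
      simp only [t]; field_simp
    obtain ⟨c, hc⟩ := hsing (M + t • R) (W.add_mem hM (W.smul_mem t hRW)) <| hdet _ <| by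
      rw [map_add, map_smul, hφR]
      rw [det_fin_three] at ht ⊢
      simp only [hφsymm M hM 2 1] at ht
      simp [hφsymm M hM 2 1]
      linear_combination ht
    have hM' : M = (c - t) • R := by rw [sub_smul, ← hc, add_sub_cancel_right]
    apply hne
    rw [hM', map_smul, hφR]
    simp
  have hmem : ∀ M ∈ W, φ M 1 1 = 0 → φ M 2 2 = 0 → ∃ c : F, M = c • R := fun M hM h1 h2 => by
    have h12 : φ M 1 2 = 0 := by simpa [h1] using (hminor M hM).symm
    refine hsing M hM (hdet M ?_)
    rw [det_fin_three, hφsymm M hM 2 1, h1, h2, h12]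
    ring
  have hpolar : ∀ A ∈ W, ∀ B ∈ W, φ A 1 1 * φ B 2 2 = φ A 2 2 * φ B 1 1 := fun A hA B hB => by
    have hAB := hminor _ (W.add_mem hA hB)
    have hA' := hminor A hA
    have hB' := hminor B hB
    simp only [map_add, Matrix.add_apply] at hAB
    have hsum : φ A 1 1 * φ B 2 2 + φ A 2 2 * φ B 1 1 = 2 * (φ A 1 2 * φ B 1 2) := by
      linear_combination hAB - hA' - hB'
    rw [← sub_eq_zero, ← sq_eq_zero_iff]
    linear_combination (φ A 1 1 * φ B 2 2 + φ A 2 2 * φ B 1 1 + 2 * (φ A 1 2 * φ B 1 2)) * hsum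
      - 4 * (φ B 1 1 * φ B 2 2) * hA' - 4 * φ A 1 2 ^ 2 * hB'
  obtain ⟨A, hspan⟩ : ∃ A, W ≤ Submodule.span F {R, A} := by
    by_cases hall : ∀ M ∈ W, φ M 1 1 = 0 ∧ φ M 2 2 = 0
    · refine ⟨0, fun M hM => ?_⟩
      obtain ⟨c, hc⟩ := hmem M hM (hall M hM).1 (hall M hM).2
      exact Submodule.mem_span_pair.2 ⟨c, 0, by simp [hc]⟩
    · push Not at hall
      obtain ⟨A, hA, hA0⟩ := hall
      refine ⟨A, fun B hB => ?_⟩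
      obtain ⟨k, hk1, hk2⟩ : ∃ k : F, φ B 1 1 = k * φ A 1 1 ∧ φ B 2 2 = k * φ A 2 2 := by
        have hAB := hpolar A hA B hB
        by_cases h1 : φ A 1 1 = 0
        · have h2 := hA0 h1
          refine ⟨φ B 2 2 / φ A 2 2, ?_, by field_simp⟩
          rw [h1, zero_mul] at hAB
          simpa [h1, h2] using hAB.symm
        · refine ⟨φ B 1 1 / φ A 1 1, by field_simp, ?_⟩
          field_simp
          linear_combination hAB
      obtain ⟨c, hc⟩ := hmem (B - k • A) (W.sub_mem hB (W.smul_mem k hA))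
        (by simp [hk1]) (by simp [hk2])
      exact Submodule.mem_span_pair.2 ⟨c, k, by rw [← hc, sub_add_cancel]⟩
  classical
  have hcard := finrank_span_finset_le_card (R := F) ({R, A} : Finset (Matrix (Fin 3) (Fin 3) F))
  rw [Finset.coe_insert, Finset.coe_singleton] at hcard
  exact (Submodule.finrank_mono hspan).trans (hcard.trans Finset.card_le_two)

/-- A singular square matrix does not have full rank. -/
theorem rank_lt_of_det_eq_zero {F n : Type*} [Field F] [Fintype n] [DecidableEq n]
    {M : Matrix n n F} (hM : M.det = 0) : M.rank < Fintype.card n := by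
  obtain ⟨v, hv, hMv⟩ := exists_mulVec_eq_zero_iff.2 hM
  have hsum := M.mulVecLin.finrank_range_add_finrank_ker
  rw [Module.finrank_fintype_fun_eq_card] at hsum
  have hpos : 0 < Module.finrank F (LinearMap.ker M.mulVecLin) :=
    Module.finrank_pos_iff_exists_ne_zero.2
      ⟨⟨v, hMv⟩, fun h => hv (congrArg Subtype.val h)⟩
  change Module.finrank F (LinearMap.range M.mulVecLin) < _
  omega

/-- A rank-one matrix of `W` spans a rank-one point of `W`. -/
theorem isPointOf_span_singleton {F : Type} [Field F]
    {W : Submodule F (Matrix (Fin 3) (Fin 3) F)} {M : Matrix (Fin 3) (Fin 3) F}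
    (hMW : M ∈ W) (hM : M.rank = 1) :
    IsPointOf F W (Submodule.span F {M}) (fun N => N.rank = 1) := by
  have hM0 : M ≠ 0 := by
    rintro rfl
    simp at hM
  refine ⟨(Submodule.span_singleton_le_iff_mem M W).2 hMW, finrank_span_singleton hM0, ?_⟩
  intro N hN hN0
  obtain ⟨c, rfl⟩ := Submodule.mem_span_singleton.1 hN
  have hc : c ≠ 0 := by
    rintro rfl
    simp at hN0
  rw [rank_smul_of_mem_nonZeroDivisors M (mem_nonZeroDivisors_of_ne_zero hc), hM]

/-- No plane of `PG(5,q)`, `q` even, has rank distribution `[1, 0, q²+q]`: there is no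
3-dimensional subspace of `Sym₃(F)` with exactly one rank-1 point and no rank-2 matrix. -/
theorem no_plane_with_rank_distribution_one_zero (h : ℕ) (hh : 0 < h)
    (F : Type) [Field F] [Fintype F] (hF : Fintype.card F = 2 ^ h) :
    ¬ ∃ W : Submodule F (Matrix (Fin 3) (Fin 3) F),
        Module.finrank F ↥W = 3 ∧ (∀ M ∈ W, M.IsSymm) ∧
        Nat.card {P | IsPointOf F W P (fun M => M.rank = 1)} = 1 ∧
        ∀ M ∈ W, M.rank ≠ 2 := by
  rintro ⟨W, hW, hsymm, hcard, hrank⟩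
  obtain ⟨⟨P, hPW, hP1, hPrank⟩, hunique⟩ := Nat.card_eq_one_iff_exists.1 hcard
  obtain ⟨⟨R, hRP⟩, hR0, -⟩ := finrank_eq_one_iff'.1 hP1
  have hR : R.rank = 1 := hPrank R hRP fun h0 => hR0 (Subtype.ext h0)
  have hspan : ∀ M ∈ W, M.rank = 1 → Submodule.span F {M} = P := fun M hM hM1 =>
    congrArg Subtype.val (hunique ⟨_, isPointOf_span_singleton hM hM1⟩)
  have hle := finrank_le_two_of_singular_mem_span W hsymm (hPW hRP) hR fun M hM hdet => by
    have hlt : M.rank < 3 := by simpa using rank_lt_of_det_eq_zero hdet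
    have hne := hrank M hM
    obtain h0 | h1 : M.rank = 0 ∨ M.rank = 1 := by omega
    · refine ⟨0, ?_⟩
      have hrange : LinearMap.range M.mulVecLin = ⊥ := Submodule.finrank_eq_zero.1 h0
      rw [LinearMap.range_eq_bot] at hrange
      rw [zero_smul]
      exact mulVec_injective (by ext1 v; simpa using LinearMap.congr_fun hrange v)
    · have hMR : M ∈ Submodule.span F {R} := by
        rw [hspan R (hPW hRP) hR, ← hspan M hM h1]
        exact Submodule.mem_span_singleton_self M
      obtain ⟨c, hc⟩ := Submodule.mem_span_singleton.1 hMR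
      exact ⟨c, hc.symm⟩
  omega
end

section
/- Let q = 2^h be a power of 2 and F a finite field with q elements. If a 3-dimensional F-linear subspace W of Sym₃(F) contains exactly two 1-dimensional subspaces spanned by rank-1 matrices, then the number of 1-dimensional subspaces of W spanned by rank-2 matrices is at least q (equivalently, no plane of PG(5,q) has rank distribution [2, r₂, r₃] with r₂ < q). -/
open Matrix

namespace Matrix

variable {F : Type*} [Field F]

theorem IsSymm.exists_eq_smul_vecMulVec_of_rank_eq_one {n : Type*} [Fintype n]
    {A : Matrix n n F} (hA : A.IsSymm) (hr : A.rank = 1) :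
    ∃ (c : F) (u : n → F), A = c • vecMulVec u u := by
  rw [rank_eq_finrank_span_cols, finrank_eq_one_iff'] at hr
  obtain ⟨⟨a, _⟩, ha, hspan⟩ := hr
  have hcol : ∀ j, ∃ c : F, ∀ i, A i j = c * a i := by
    intro j
    obtain ⟨c, hc⟩ := hspan ⟨A.col j, Submodule.subset_span ⟨j, rfl⟩⟩
    refine ⟨c, fun i => ?_⟩
    have := congrFun (congrArg Subtype.val hc) i
    simpa using this.symm
  choose c hc using hcol
  have ha' : a ≠ 0 := fun h => ha (Subtype.ext h)
  obtain ⟨k, hk⟩ := Function.ne_iff.mp ha'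
  have hk : a k ≠ 0 := hk
  refine ⟨c k / a k, a, ?_⟩
  ext i j
  have h := hA.apply j k
  rw [hc, hc] at h
  rw [hc, smul_apply, vecMulVec_apply, smul_eq_mul]
  field_simp
  linear_combination a i * h

theorem rank_eq_zero_iff {m n : Type*} [Fintype n] [Finite m] {A : Matrix m n F} :
    A.rank = 0 ↔ A = 0 := by
  refine ⟨fun h => ?_, fun h => by rw [h, rank_zero]⟩
  rw [rank_eq_finrank_span_cols, Submodule.finrank_eq_zero, Submodule.span_eq_bot] at h
  ext i j
  exact congrFun (h _ ⟨j, rfl⟩) i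

theorem rank_lt_card_of_det_eq_zero {n : Type*} [Fintype n] [DecidableEq n] {A : Matrix n n F}
    (h : A.det = 0) : A.rank < Fintype.card n := by
  obtain ⟨w, hw, hAw⟩ := exists_mulVec_eq_zero_iff.mpr h
  have hker : A.mulVecLin.ker ≠ ⊥ := fun hb =>
    hw ((Submodule.mem_bot F).mp (hb ▸ (show w ∈ A.mulVecLin.ker from hAw)))
  have hpos : Module.finrank F A.mulVecLin.ker ≠ 0 := by rwa [Ne, Submodule.finrank_eq_zero]
  have := A.mulVecLin.finrank_range_add_finrank_ker
  rw [Module.finrank_fintype_fun_eq_card] at this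
  unfold rank
  omega

theorem exists_det_cols_ne_zero {u v : Fin 3 → F} (h : LinearIndependent F ![u, v]) :
    ∃ w, (of ![u, v, w])ᵀ.det ≠ 0 := by
  obtain ⟨w, hw⟩ := exists_linearIndependent_snoc_of_lt_finrank h (by simp)
  refine ⟨w, ?_⟩
  have e : (Fin.snoc ![u, v] w : Fin 3 → Fin 3 → F) = (of ![u, v, w]).row := by
    ext i j
    fin_cases i <;> rfl
  rw [e, linearIndependent_rows_iff_isUnit, isUnit_iff_isUnit_det] at hw
  rw [det_transpose]
  exact hw.ne_zero

theorem det_smul_vecMulVec_add_smul_vecMulVec (u v : Fin 3 → F) (x y : F) :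
    (x • vecMulVec u u + y • vecMulVec v v).det = 0 := by
  simp only [det_fin_three, add_apply, smul_apply, vecMulVec_apply, smul_eq_mul]
  ring

theorem exists_det_diagonal_add_eq_zero {N : Matrix (Fin 3) (Fin 3) F} (hN : N.IsSymm) :
    ∃ x y : F, (diagonal ![x, y, 0] + N).det = 0 := by
  have h01 := hN.apply 0 1
  have h02 := hN.apply 0 2
  have h12 := hN.apply 1 2
  have key : ∀ x y, (diagonal ![x, y, 0] + N).det =
      (x + N 0 0) * (y + N 1 1) * N 2 2 - (x + N 0 0) * N 1 2 ^ 2 - (y + N 1 1) * N 0 2 ^ 2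
        - N 2 2 * N 0 1 ^ 2 + 2 * N 0 1 * N 0 2 * N 1 2 := by
    intro x y
    simp [det_fin_three, h01, h02, h12]
    ring
  by_cases hd : N 2 2 = 0
  · by_cases hc : N 1 2 = 0
    · refine ⟨0, -N 1 1, ?_⟩
      rw [key, hd, hc]
      ring
    · refine ⟨2 * N 0 1 * N 0 2 / N 1 2 - N 0 0, -N 1 1, ?_⟩
      rw [key, hd]
      field_simp
      ring
  · refine ⟨(1 + N 0 2 ^ 2) / N 2 2 - N 0 0, (1 + N 0 2 ^ 2) / N 2 2 * N 1 2 ^ 2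
      + N 2 2 * N 0 1 ^ 2 - 2 * N 0 1 * N 0 2 * N 1 2 - N 1 1, ?_⟩
    rw [key]
    field_simp
    ring

theorem exists_det_smul_vecMulVec_add_eq_zero {u v : Fin 3 → F}
    (h : LinearIndependent F ![u, v]) {M : Matrix (Fin 3) (Fin 3) F} (hM : M.IsSymm) :
    ∃ x y : F, (x • vecMulVec u u + y • vecMulVec v v + M).det = 0 := by
  obtain ⟨w, hw⟩ := exists_det_cols_ne_zero h
  set g := (of ![u, v, w])ᵀ with hg
  have hu : IsUnit g.det := hw.isUnit
  have hN : (g⁻¹ * M * g⁻¹ᵀ).IsSymm := by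
    rw [IsSymm, transpose_mul, transpose_mul, transpose_transpose, hM.eq, Matrix.mul_assoc]
  obtain ⟨x, y, hxy⟩ := exists_det_diagonal_add_eq_zero hN
  refine ⟨x, y, ?_⟩
  have hD : x • vecMulVec u u + y • vecMulVec v v = g * diagonal ![x, y, 0] * gᵀ := by
    ext i j
    simp [hg, mul_apply, Fin.sum_univ_three, diagonal, vecMulVec_apply]
    ring
  have hMg : M = g * (g⁻¹ * M * g⁻¹ᵀ) * gᵀ := by
    rw [transpose_nonsing_inv, ← Matrix.mul_assoc, ← Matrix.mul_assoc, mul_nonsing_inv g hu,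
      Matrix.one_mul, Matrix.mul_assoc, nonsing_inv_mul _ (by rwa [det_transpose]),
      Matrix.mul_one]
  rw [hD, hMg, ← Matrix.add_mul, ← Matrix.mul_add, det_mul, det_mul, hxy]
  simp

end Matrix

section Points

variable {F : Type} [Field F] {W P : Submodule F (Matrix (Fin 3) (Fin 3) F)}

theorem isPointOf_span_singleton_rank {A : Matrix (Fin 3) (Fin 3) F} (hA : A ∈ W) (h0 : A ≠ 0) :
    IsPointOf F W (F ∙ A) (fun M => M.rank = A.rank) := by
  refine ⟨(Submodule.span_singleton_le_iff_mem _ _).mpr hA, finrank_span_singleton h0, ?_⟩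
  intro M hM hM0
  obtain ⟨c, rfl⟩ := Submodule.mem_span_singleton.mp hM
  have hc : c ≠ 0 := fun h => hM0 (by rw [h, zero_smul])
  exact Matrix.rank_smul_of_mem_nonZeroDivisors A (mem_nonZeroDivisors_of_ne_zero hc)

theorem IsPointOf.exists_eq_span_vecMulVec (hsymm : ∀ M ∈ W, M.IsSymm)
    (hP : IsPointOf F W P (fun M => M.rank = 1)) :
    ∃ u : Fin 3 → F, vecMulVec u u ≠ 0 ∧ P = F ∙ vecMulVec u u := by
  obtain ⟨hPW, hP1, hrank⟩ := hP
  obtain ⟨⟨A, hAP⟩, hA0, hspan⟩ := finrank_eq_one_iff'.mp hP1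
  have hA0 : A ≠ 0 := fun h => hA0 (Subtype.ext h)
  obtain ⟨c, u, hcu⟩ :=
    (hsymm A (hPW hAP)).exists_eq_smul_vecMulVec_of_rank_eq_one (hrank A hAP hA0)
  have hc : c ≠ 0 := by
    rintro rfl
    exact hA0 (by rw [hcu, zero_smul])
  refine ⟨u, fun h => hA0 (by rw [hcu, h, smul_zero]), ?_⟩
  rw [← Submodule.span_singleton_smul_eq hc.isUnit, ← hcu]
  refine le_antisymm (fun M hM => ?_) ((Submodule.span_singleton_le_iff_mem _ _).mpr hAP)
  obtain ⟨d, hd⟩ := hspan ⟨M, hM⟩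
  exact Submodule.mem_span_singleton.mpr ⟨d, congrArg Subtype.val hd⟩

theorem linearIndependent_pair_of_span_singleton_ne {V : Type*} [AddCommGroup V] [Module F V]
    {x y : V} (hx : x ≠ 0) (hy : y ≠ 0) (h : (F ∙ x) ≠ F ∙ y) : LinearIndependent F ![x, y] := by
  refine (LinearIndependent.pair_iff' hx).mpr ?_
  rintro a rfl
  have ha : a ≠ 0 := fun h0 => hy (by rw [h0, zero_smul])
  exact h (Submodule.span_singleton_smul_eq ha.isUnit x).symm

theorem linearIndependent_pair_of_span_vecMulVec_ne {u v : Fin 3 → F} (hu : vecMulVec u u ≠ 0)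
    (hv : vecMulVec v v ≠ 0) (h : (F ∙ vecMulVec u u) ≠ F ∙ vecMulVec v v) :
    LinearIndependent F ![u, v] := by
  have hu0 : u ≠ 0 := by
    rintro rfl
    exact hu (zero_vecMulVec 0)
  refine (LinearIndependent.pair_iff' hu0).mpr ?_
  rintro a rfl
  have ha : a ≠ 0 := fun h0 => hv (by rw [h0, zero_smul, zero_vecMulVec])
  rw [smul_vecMulVec, vecMulVec_smul, Submodule.span_singleton_smul_eq ha.isUnit,
    Submodule.span_singleton_smul_eq ha.isUnit] at h
  exact h rfl

theorem Submodule.exists_mem_notMem_span_pair {V : Type*} [AddCommGroup V] [Module F V]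
    {W : Submodule F V} (hdim : 2 < Module.finrank F W) (x y : V) :
    ∃ z ∈ W, z ∉ Submodule.span F {x, y} := by
  by_contra! hle
  have h2 := finrank_range_le_card (R := F) ![x, y]
  rw [Matrix.range_cons_cons_empty, Fintype.card_fin] at h2
  have hfin : FiniteDimensional F (Submodule.span F {x, y}) :=
    FiniteDimensional.span_of_finite F (Set.toFinite _)
  have := Submodule.finrank_mono (show W ≤ Submodule.span F {x, y} from hle)
  rw [Set.finrank] at h2
  omega

theorem injective_span_pencil_point {V : Type*} [AddCommGroup V] [Module F V] [DecidableEq F]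
    {x y z : V} (hxy : LinearIndependent F ![x, y]) (hz : z ∉ Submodule.span F {x, y}) :
    Function.Injective fun t : F => if t = 0 then F ∙ z else F ∙ (x + t • y) := by
  have hzne : ∀ t : F, (F ∙ z) ≠ F ∙ (x + t • y) := fun t h => hz <| by
    have hzt : z ∈ F ∙ (x + t • y) := h ▸ Submodule.mem_span_singleton_self z
    refine (Submodule.span_singleton_le_iff_mem _ _).mpr ?_ hzt
    exact Submodule.mem_span_pair.mpr ⟨1, t, by rw [one_smul]⟩
  intro s t hst
  by_cases hs : s = 0 <;> by_cases ht : t = 0 <;> simp only [hs, ht, if_true, if_false] at hst ⊢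
  · exact absurd hst (hzne t)
  · exact absurd hst.symm (hzne s)
  · obtain ⟨c, hc⟩ := Submodule.mem_span_singleton.mp
      (hst ▸ Submodule.mem_span_singleton_self (x + s • y))
    have h0 : (c - 1) • x + (c * t - s) • y = 0 :=
      Eq.trans (by module) (sub_eq_zero.mpr hc)
    obtain ⟨h1, h2⟩ := LinearIndependent.pair_iff.mp hxy _ _ h0
    linear_combination t * h1 - h2

end Points

/-- No plane of `PG(5,q)`, `q` even, has rank distribution `[2, r₂, r₃]` with `r₂ < q`: a
3-dimensional subspace of `Sym₃(F)` with exactly two rank-1 points has at least `q`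
rank-2 points. -/
theorem plane_with_two_rank_one_points_has_many_rank_two_points (h : ℕ) (hh : 0 < h)
    (F : Type) [Field F] [Fintype F] (hF : Fintype.card F = 2 ^ h)
    (W : Submodule F (Matrix (Fin 3) (Fin 3) F))
    (hdim : Module.finrank F ↥W = 3) (hsymm : ∀ M ∈ W, M.IsSymm)
    (h1 : Nat.card {P | IsPointOf F W P (fun M => M.rank = 1)} = 2) :
    2 ^ h ≤ Nat.card {P | IsPointOf F W P (fun M => M.rank = 2)} := by
  classical
  rw [Nat.card_coe_set_eq] at h1
  obtain ⟨P, Q, hPQ, hset⟩ := Set.ncard_eq_two.mp h1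
  have hP : IsPointOf F W P (fun M => M.rank = 1) :=
    hset.symm.subset (Set.mem_insert P {Q})
  have hQ : IsPointOf F W Q (fun M => M.rank = 1) :=
    hset.symm.subset (Set.mem_insert_of_mem P rfl)
  obtain ⟨u, hu, rfl⟩ := hP.exists_eq_span_vecMulVec hsymm
  obtain ⟨v, hv, rfl⟩ := hQ.exists_eq_span_vecMulVec hsymm
  have huv := linearIndependent_pair_of_span_vecMulVec_ne hu hv hPQ
  have hAB := linearIndependent_pair_of_span_singleton_ne hu hv hPQ
  have hA := (Submodule.span_singleton_le_iff_mem _ _).mp hP.1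
  have hB := (Submodule.span_singleton_le_iff_mem _ _).mp hQ.1
  have hdet := Matrix.det_smul_vecMulVec_add_smul_vecMulVec u v
  obtain ⟨M, hM, hMAB⟩ := Submodule.exists_mem_notMem_span_pair
    (show 2 < Module.finrank F W by omega) (vecMulVec u u) (vecMulVec v v)
  obtain ⟨x, y, hxy⟩ := Matrix.exists_det_smul_vecMulVec_add_eq_zero huv (hsymm M hM)
  generalize vecMulVec u u = A at *
  generalize vecMulVec v v = B at *
  have rank_two : ∀ Z ∈ W, Z.det = 0 → Z ∉ (F ∙ A) → Z ∉ (F ∙ B) →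
      IsPointOf F W (F ∙ Z) (fun M => M.rank = 2) := by
    intro Z hZ hZdet hZA hZB
    have hZ0 : Z ≠ 0 := by
      rintro rfl
      exact hZA (zero_mem _)
    have hpt := isPointOf_span_singleton_rank hZ hZ0
    have hr0 : Z.rank ≠ 0 := mt Matrix.rank_eq_zero_iff.mp hZ0
    have hr1 : Z.rank ≠ 1 := by
      intro hr
      rw [hr] at hpt
      have hmem := Submodule.mem_span_singleton_self (R := F) Z
      rcases hset.subset hpt with h | h
      · exact hZA (h ▸ hmem)
      · exact hZB (h ▸ hmem)
    have hr3 := Matrix.rank_lt_card_of_det_eq_zero hZdet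
    rw [Fintype.card_fin] at hr3
    rwa [show Z.rank = 2 by omega] at hpt
  have hABspan : x • A + y • B ∈ Submodule.span F {A, B} :=
    Submodule.mem_span_pair.mpr ⟨x, y, rfl⟩
  have hN : x • A + y • B + M ∉ Submodule.span F {A, B} := fun hN =>
    hMAB ((Submodule.add_mem_iff_right _ hABspan).mp hN)
  have hpoint : ∀ t : F, IsPointOf F W
      (if t = 0 then F ∙ (x • A + y • B + M) else F ∙ (A + t • B)) (fun M => M.rank = 2) := by
    intro t
    split_ifs with ht
    · refine rank_two _ (add_mem (add_mem (W.smul_mem x hA) (W.smul_mem y hB)) hM) hxy ?_ ?_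
      · exact fun hmem => hN (Submodule.span_mono (by simp) hmem)
      · exact fun hmem => hN (Submodule.span_mono (by simp) hmem)
    · refine rank_two _ (add_mem hA (W.smul_mem t hB)) (by simpa using hdet 1 t) ?_ ?_ <;>
        intro hmem <;> obtain ⟨c, hc⟩ := Submodule.mem_span_singleton.mp hmem
      · have h0 : (1 - c) • A + t • B = 0 :=
          Eq.trans (by module) (sub_eq_zero.mpr hc.symm)
        exact ht (LinearIndependent.pair_iff.mp hAB _ _ h0).2
      · have h0 : (1 : F) • A + (t - c) • B = 0 :=
          Eq.trans (by module) (sub_eq_zero.mpr hc.symm)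
        exact one_ne_zero (LinearIndependent.pair_iff.mp hAB _ _ h0).1
  rw [← hF, ← Nat.card_eq_fintype_card]
  refine Nat.card_le_card_of_injective (fun t : F => ⟨_, hpoint t⟩) fun s t hst => ?_
  exact injective_span_pencil_point hAB hN (congrArg Subtype.val hst)
end

section
/- Let q = 2^h be a power of 2 and F a finite field with q elements. Let W₁ = { [[x, y, 0], [y, z, 0], [0, 0, 0]] : x, y, z ∈ F } ⊆ Sym₃(F) (a conic plane of the Veronese surface). Then the point-orbit distribution of W₁ is [q+1, 1, q²−1, 0]: W₁ has exactly q+1 rank-1 points, exactly one rank-2 point with zero diagonal, exactly q²−1 rank-2 points with nonzero diagonal, and no rank-3 points. -/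
open Matrix

/-- The symmetric matrix `[[x, y, 0], [y, z, 0], [0, 0, 0]]`. -/
def conicMatrix {F : Type} [Field F] (x y z : F) : Matrix (Fin 3) (Fin 3) F :=
  !![x, y, 0; y, z, 0; 0, 0, 0]

section

variable {F : Type} [Field F]

theorem conicMatrix_inj {x y z x' y' z' : F} :
    conicMatrix x y z = conicMatrix x' y' z' ↔ x = x' ∧ y = y' ∧ z = z' := by
  refine ⟨fun e => ⟨?_, ?_, ?_⟩, by rintro ⟨rfl, rfl, rfl⟩; rfl⟩
  · simpa [conicMatrix] using congr_fun₂ e 0 0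
  · simpa [conicMatrix] using congr_fun₂ e 0 1
  · simpa [conicMatrix] using congr_fun₂ e 1 1

theorem conicMatrix_zero : conicMatrix (0 : F) 0 0 = 0 := by
  ext i j; fin_cases i <;> fin_cases j <;> rfl

theorem smul_conicMatrix (c x y z : F) :
    c • conicMatrix x y z = conicMatrix (c * x) (c * y) (c * z) := by
  ext i j; fin_cases i <;> fin_cases j <;> simp [conicMatrix]

theorem conicMatrix_eq_zero_iff {x y z : F} :
    conicMatrix x y z = 0 ↔ x = 0 ∧ y = 0 ∧ z = 0 := by
  rw [← conicMatrix_zero, conicMatrix_inj]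

theorem forall_diag_conicMatrix {x y z : F} :
    (∀ i, conicMatrix x y z i i = 0) ↔ x = 0 ∧ z = 0 := by
  simp [Fin.forall_fin_succ, conicMatrix]

theorem exists_diag_conicMatrix {x y z : F} :
    (∃ i, conicMatrix x y z i i ≠ 0) ↔ ¬(x = 0 ∧ z = 0) := by
  rw [← forall_diag_conicMatrix (y := y), not_forall]

theorem rank_conicMatrix_of_ne {x y z : F} (hd : x * z ≠ y ^ 2) :
    (conicMatrix x y z).rank = 2 := by
  apply le_antisymm
  · have e : conicMatrix x y z = !![x, y; y, z; 0, 0] * (!![1, 0, 0; 0, 1, 0] : Matrix (Fin 2) (Fin 3) F) := by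
      ext i j; fin_cases i <;> fin_cases j <;> simp [conicMatrix, Matrix.mul_apply]
    rw [e]
    exact (rank_mul_le_left _ _).trans (rank_le_width _)
  · have e : !![x, y; y, z] =
        (!![1, 0, 0; 0, 1, 0] : Matrix (Fin 2) (Fin 3) F) * conicMatrix x y z *
          (!![1, 0; 0, 1; 0, 0] : Matrix (Fin 3) (Fin 2) F) := by
      ext i j; fin_cases i <;> fin_cases j <;>
        simp [conicMatrix, Matrix.mul_apply, Fin.sum_univ_succ]
    have hu : IsUnit !![x, y; y, z] := by
      rw [Matrix.isUnit_iff_isUnit_det, det_fin_two_of, isUnit_iff_ne_zero, sub_ne_zero, ← sq]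
      exact hd
    have hr := rank_of_isUnit _ hu
    rw [e, Fintype.card_fin] at hr
    rw [← hr]
    exact (rank_mul_le_left _ _).trans (rank_mul_le_right _ _)

theorem rank_conicMatrix_of_eq {x y z : F} (hd : x * z = y ^ 2) (h0 : conicMatrix x y z ≠ 0) :
    (conicMatrix x y z).rank = 1 := by
  apply le_antisymm
  · by_cases hx : x = 0
    · have hy : y = 0 := by simpa [hx, @eq_comm F 0] using hd
      have e : conicMatrix x y z = vecMulVec ![0, z, 0] ![0, 1, 0] := by
        subst hx hy
        ext i j; fin_cases i <;> fin_cases j <;> simp [conicMatrix, vecMulVec_apply]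
      rw [e]
      exact rank_vecMulVec_le _ _
    · have e : conicMatrix x y z = vecMulVec ![x, y, 0] ![1, y / x, 0] := by
        have hz : z = y * (y / x) := by field_simp; linear_combination hd
        have hy : y = x * (y / x) := by field_simp
        ext i j; fin_cases i <;> fin_cases j <;> simp [conicMatrix, vecMulVec_apply] <;> assumption
      rw [e]
      exact rank_vecMulVec_le _ _
  · rw [Nat.one_le_iff_ne_zero]
    intro hr
    rw [Matrix.rank, Submodule.finrank_eq_zero, LinearMap.range_eq_bot] at hr
    exact h0 (ext_of_mulVec_single fun j => by
      rw [zero_mulVec]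
      exact LinearMap.congr_fun hr (Pi.single j 1))

theorem rank_conicMatrix_eq_one_iff {x y z : F} (h0 : conicMatrix x y z ≠ 0) :
    (conicMatrix x y z).rank = 1 ↔ x * z = y ^ 2 := by
  refine ⟨fun hr => ?_, fun hd => rank_conicMatrix_of_eq hd h0⟩
  by_contra hd
  simp [rank_conicMatrix_of_ne hd] at hr

theorem rank_conicMatrix_eq_two_iff {x y z : F} (h0 : conicMatrix x y z ≠ 0) :
    (conicMatrix x y z).rank = 2 ↔ x * z ≠ y ^ 2 := by
  refine ⟨fun hr hd => ?_, rank_conicMatrix_of_ne⟩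
  simp [rank_conicMatrix_of_eq hd h0] at hr

/-- Points of `W` satisfying `pred` are counted by a family of matrices that meets each of them in
exactly one nonzero matrix. -/
theorem card_isPointOf_eq {α : Type} (W : Submodule F (Matrix (Fin 3) (Fin 3) F))
    (pred : Matrix (Fin 3) (Fin 3) F → Prop) (g : α → Matrix (Fin 3) (Fin 3) F)
    (hW : ∀ a, g a ∈ W) (h0 : ∀ a, g a ≠ 0)
    (hpred : ∀ a (c : F), c ≠ 0 → pred (c • g a))
    (hinj : ∀ a b (c : F), c • g a = g b → a = b)
    (hsurj : ∀ M ∈ W, M ≠ 0 → pred M → ∃ a, ∃ c : F, c • g a = M) :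
    Nat.card {P | IsPointOf F W P pred} = Nat.card α := by
  symm
  refine Nat.card_congr (Equiv.ofBijective
    (fun a => ⟨Submodule.span F {g a}, ?_, finrank_span_singleton (h0 a), ?_⟩) ⟨?_, ?_⟩)
  · simpa using hW a
  · intro M hM hM0
    obtain ⟨c, rfl⟩ := Submodule.mem_span_singleton.1 hM
    exact hpred a c fun hc => hM0 (by simp [hc])
  · intro a b hab
    have hs : Submodule.span F {g a} = Submodule.span F {g b} := congrArg Subtype.val hab
    obtain ⟨c, hc⟩ := Submodule.mem_span_singleton.1
      (hs ▸ Submodule.mem_span_singleton_self (g b) : g b ∈ Submodule.span F {g a})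
    exact hinj a b c hc
  · rintro ⟨P, hPW, hP1, hP⟩
    obtain ⟨⟨M, hMP⟩, hM0, -⟩ := finrank_eq_one_iff'.1 hP1
    have hM0 : M ≠ 0 := fun e => hM0 (Subtype.ext e)
    obtain ⟨a, c, rfl⟩ := hsurj M (hPW hMP) hM0 (hP M hMP hM0)
    have hc : c ≠ 0 := fun hc => hM0 (by simp [hc])
    have hgP : g a ∈ P := by simpa [smul_smul, hc] using P.smul_mem c⁻¹ hMP
    have : FiniteDimensional F P := Module.finite_of_finrank_eq_succ hP1
    refine ⟨a, Subtype.ext (Submodule.eq_of_le_of_finrank_eq ?_ ?_)⟩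
    · simpa using hgP
    · rw [finrank_span_singleton (h0 a), hP1]

theorem card_rank_one_points [Finite F] {W : Submodule F (Matrix (Fin 3) (Fin 3) F)}
    (hW : ∀ M, M ∈ W ↔ ∃ x y z : F, M = conicMatrix x y z) :
    Nat.card {P | IsPointOf F W P (fun M => M.rank = 1)} = Nat.card F + 1 := by
  let g : Option F → Matrix (Fin 3) (Fin 3) F
    | none => conicMatrix 0 0 1
    | some y => conicMatrix 1 y (y ^ 2)
  rw [card_isPointOf_eq W _ g, Finite.card_option]
  · rintro (_ | y) <;> exact (hW _).2 ⟨_, _, _, rfl⟩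
  · rintro (_ | y) <;> simp [g, conicMatrix_eq_zero_iff]
  · rintro (_ | y) c hc <;> simp only [g, smul_conicMatrix] <;>
      refine rank_conicMatrix_of_eq (by ring) ?_ <;> simp [conicMatrix_eq_zero_iff, hc]
  · rintro (_ | y) (_ | y') c e <;> simp [g, smul_conicMatrix, conicMatrix_inj] at e ⊢
    · obtain ⟨rfl, -, e⟩ := e
      simp at e
    · obtain ⟨rfl, e, -⟩ := e
      simpa using e
  · intro M hM h0 hr
    obtain ⟨x, y, z, rfl⟩ := (hW M).1 hM
    rw [rank_conicMatrix_eq_one_iff h0] at hr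
    by_cases hx : x = 0
    · refine ⟨none, z, ?_⟩
      have hy : y = 0 := by simpa [hx, @eq_comm F 0] using hr
      simp [g, smul_conicMatrix, hx, hy]
    · refine ⟨some (y / x), x, ?_⟩
      simp only [g, smul_conicMatrix, conicMatrix_inj]
      refine ⟨by ring, by field_simp, ?_⟩
      field_simp
      exact hr.symm

theorem card_rank_two_points_diag_eq_zero {W : Submodule F (Matrix (Fin 3) (Fin 3) F)}
    (hW : ∀ M, M ∈ W ↔ ∃ x y z : F, M = conicMatrix x y z) :
    Nat.card {P | IsPointOf F W P (fun M => M.rank = 2 ∧ ∀ i, M i i = 0)} = 1 := by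
  rw [card_isPointOf_eq W _ (fun _ : Unit => conicMatrix 0 1 0), Nat.card_unique]
  · exact fun _ => (hW _).2 ⟨_, _, _, rfl⟩
  · simp [conicMatrix_eq_zero_iff]
  · intro _ c hc
    rw [smul_conicMatrix, forall_diag_conicMatrix]
    exact ⟨rank_conicMatrix_of_ne (by simp [@eq_comm F 0, hc]), by simp⟩
  · simp
  · rintro M hM h0 ⟨-, hd⟩
    obtain ⟨x, y, z, rfl⟩ := (hW M).1 hM
    obtain ⟨rfl, rfl⟩ := forall_diag_conicMatrix.1 hd
    exact ⟨(), y, by simp [smul_conicMatrix]⟩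

theorem card_rank_two_points_diag_ne_zero [Finite F] {W : Submodule F (Matrix (Fin 3) (Fin 3) F)}
    (hW : ∀ M, M ∈ W ↔ ∃ x y z : F, M = conicMatrix x y z) :
    Nat.card {P | IsPointOf F W P (fun M => M.rank = 2 ∧ ∃ i, M i i ≠ 0)} =
      Nat.card F ^ 2 - 1 := by
  let g : Option F × Fˣ → Matrix (Fin 3) (Fin 3) F
    | (none, t) => conicMatrix 0 1 t
    | (some y, t) => conicMatrix 1 y (y ^ 2 + t)
  rw [card_isPointOf_eq W _ g, Nat.card_prod, Finite.card_option, Nat.card_units,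
    ← Nat.sq_sub_sq, one_pow]
  · rintro ⟨_ | y, t⟩ <;> exact (hW _).2 ⟨_, _, _, rfl⟩
  · rintro ⟨_ | y, t⟩ <;> simp [g, conicMatrix_eq_zero_iff]
  · rintro ⟨_ | y, t⟩ c hc <;> simp only [g, smul_conicMatrix, exists_diag_conicMatrix] <;>
      refine ⟨rank_conicMatrix_of_ne ?_, by simp [hc]⟩
    · simp [@eq_comm F 0, hc]
    · rw [← sub_ne_zero]
      have e : c * 1 * (c * (y ^ 2 + t)) - (c * y) ^ 2 = c ^ 2 * t := by ring
      rw [e]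
      simp [hc]
  · rintro ⟨_ | y, t⟩ ⟨_ | y', t'⟩ c e <;>
      simp [g, smul_conicMatrix, conicMatrix_inj] at e ⊢
    · obtain ⟨rfl, e⟩ := e
      simpa [Units.ext_iff] using e
    · simp [e.1] at e
    · obtain ⟨rfl, rfl, e⟩ := e
      simpa [Units.ext_iff] using e
  · rintro M hM h0 ⟨hr, hd⟩
    obtain ⟨x, y, z, rfl⟩ := (hW M).1 hM
    rw [rank_conicMatrix_eq_two_iff h0] at hr
    rw [exists_diag_conicMatrix] at hd
    by_cases hx : x = 0
    · have hy : y ≠ 0 := by simpa [hx, @eq_comm F 0] using hr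
      have hz : z ≠ 0 := fun hz => hd ⟨hx, hz⟩
      refine ⟨(none, Units.mk0 (z / y) (div_ne_zero hz hy)), y, ?_⟩
      simp only [g, smul_conicMatrix, conicMatrix_inj, Units.val_mk0]
      exact ⟨by simp [hx], by ring, by field_simp⟩
    · refine ⟨(some (y / x), Units.mk0 ((x * z - y ^ 2) / x ^ 2)
        (div_ne_zero (sub_ne_zero.2 hr) (pow_ne_zero 2 hx))), x, ?_⟩
      simp only [g, smul_conicMatrix, conicMatrix_inj, Units.val_mk0]
      refine ⟨by ring, by field_simp, ?_⟩
      field_simp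
      ring

theorem card_rank_three_points {W : Submodule F (Matrix (Fin 3) (Fin 3) F)}
    (hW : ∀ M, M ∈ W ↔ ∃ x y z : F, M = conicMatrix x y z) :
    Nat.card {P | IsPointOf F W P (fun M => M.rank = 3)} = 0 := by
  rw [card_isPointOf_eq W _ (fun a : Empty => a.elim), Nat.card_of_isEmpty]
  iterate 4 exact fun a => a.elim
  intro M hM h0 hr
  obtain ⟨x, y, z, rfl⟩ := (hW M).1 hM
  by_cases hd : x * z = y ^ 2
  · simp [rank_conicMatrix_of_eq hd h0] at hr
  · simp [rank_conicMatrix_of_ne hd] at hr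

end

/-- The point-orbit distribution of the conic plane `Σ₁` is `[q+1, 1, q²-1, 0]`. -/
theorem sigma1_point_orbit_distribution (h : ℕ) (hh : 0 < h)
    (F : Type) [Field F] [Fintype F] (hF : Fintype.card F = 2 ^ h)
    (W : Submodule F (Matrix (Fin 3) (Fin 3) F))
    (hW : (W : Set (Matrix (Fin 3) (Fin 3) F)) =
      {M | ∃ x y z : F, M = !![x, y, 0; y, z, 0; 0, 0, 0]}) :
    Nat.card {P | IsPointOf F W P (fun M => M.rank = 1)} = 2 ^ h + 1 ∧
    Nat.card {P | IsPointOf F W P (fun M => M.rank = 2 ∧ ∀ i, M i i = 0)} = 1 ∧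
    Nat.card {P | IsPointOf F W P (fun M => M.rank = 2 ∧ ∃ i, M i i ≠ 0)} = (2 ^ h) ^ 2 - 1 ∧
    Nat.card {P | IsPointOf F W P (fun M => M.rank = 3)} = 0 := by
  have hmem : ∀ M, M ∈ W ↔ ∃ x y z : F, M = conicMatrix x y z := fun M => Set.ext_iff.1 hW M
  rw [← hF, ← Nat.card_eq_fintype_card]
  exact ⟨card_rank_one_points hmem, card_rank_two_points_diag_eq_zero hmem,
    card_rank_two_points_diag_ne_zero hmem, card_rank_three_points hmem⟩
end

section
/- Let q = 2^h be a power of 2, F a finite field with q elements, and c ∈ F a nonzero element with Tr(c⁻¹) = 1. Let W₆ = { [[x, 0, 0], [0, y + c z, z], [0, z, y]] : x, y, z ∈ F } ⊆ Sym₃(F). Then the point-orbit distribution of W₆ is [1, 0, q+1, q²−1]: W₆ has exactly one rank-1 point, no rank-2 points with zero diagonal, exactly q+1 rank-2 points with nonzero diagonal, and exactly q²−1 rank-3 points. -/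
open Matrix

/-- The absolute trace map `Tr : F → F₂ ⊆ F` of a finite field `F` of order `2^h`,
`Tr(x) = x + x² + x⁴ + ⋯ + x^(2^(h-1))`. -/
def AbsTrace (F : Type) [Field F] (h : ℕ) (x : F) : F :=
  ∑ i ∈ Finset.range h, x ^ 2 ^ i

/-- The number of one-dimensional subspaces of `V` contained in a union of punctured lines `S`
(together with `0`) is `|S| / (q - 1)`. -/
theorem card_lines_mul_card_sub_one {F V : Type*} [Field F] [Finite F] [AddCommGroup V]
    [Module F V] [Finite V] (S : Set V) (h0 : ∀ v ∈ S, v ≠ 0)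
    (hS : ∀ (a : F), a ≠ 0 → ∀ v ∈ S, a • v ∈ S) :
    Nat.card {P : Submodule F V | Module.finrank F P = 1 ∧ ∀ v ∈ P, v ≠ 0 → v ∈ S} *
      (Nat.card F - 1) = Nat.card S := by
  classical
  have := Fintype.ofFinite F
  have := Fintype.ofFinite V
  have := Fintype.ofFinite (Submodule F V)
  have key := Finset.card_eq_sum_card_fiberwise (s := S.toFinset)
    (t := {P : Submodule F V | Module.finrank F P = 1 ∧ ∀ v ∈ P, v ≠ 0 → v ∈ S}.toFinset)
    (f := fun v => Submodule.span F {v}) (by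
      intro v hv
      simp only [Set.coe_toFinset] at hv
      simp only [Set.coe_toFinset, Set.mem_ofPred_eq]
      refine ⟨finrank_span_singleton (h0 v hv), fun w hw hw0 => ?_⟩
      obtain ⟨a, rfl⟩ := Submodule.mem_span_singleton.1 hw
      exact hS a (by rintro rfl; simp at hw0) v hv)
  rw [Nat.card_eq_card_toFinset, Nat.card_eq_card_toFinset, key, ← smul_eq_mul]
  symm
  apply Finset.sum_const_nat
  intro P hP
  simp only [Set.mem_toFinset, Set.mem_ofPred_eq] at hP
  have hfib : {v ∈ S.toFinset | Submodule.span F {v} = P} =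
      (P : Set V).toFinset.erase 0 := by
    ext v
    simp only [Finset.mem_filter, Set.mem_toFinset, Finset.mem_erase, SetLike.mem_coe]
    constructor
    · rintro ⟨hv, rfl⟩
      exact ⟨h0 v hv, Submodule.mem_span_singleton_self v⟩
    · rintro ⟨hv, hvP⟩
      refine ⟨hP.2 v hvP hv, ?_⟩
      refine Submodule.eq_of_le_of_finrank_eq
        ((Submodule.span_singleton_le_iff_mem v P).2 hvP) ?_
      rw [finrank_span_singleton hv, hP.1]
  rw [hfib, Finset.card_erase_of_mem (by simp), ← Nat.card_eq_card_toFinset]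
  have hc := Module.natCard_eq_pow_finrank (K := F) (V := P)
  rw [hP.1, pow_one] at hc
  rw [← hc]
  rfl

theorem absTrace_sq_add_self {F : Type} [Field F] [CharP F 2] (h : ℕ) (t : F) :
    AbsTrace F h (t ^ 2 + t) = t ^ 2 ^ h + t := by
  unfold AbsTrace
  have e : ∀ i, (t ^ 2 + t) ^ 2 ^ i = t ^ 2 ^ (i + 1) - t ^ 2 ^ i := fun i => by
    rw [add_pow_char_pow, ← pow_mul, ← pow_succ', CharTwo.sub_eq_add]
  simp_rw [e]
  rw [Finset.sum_range_sub (fun i => t ^ 2 ^ i), CharTwo.sub_eq_add, pow_zero, pow_one]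

theorem absTrace_sq {F : Type} [Field F] [CharP F 2] (h : ℕ) (t : F) :
    AbsTrace F h (t ^ 2) = AbsTrace F h t ^ 2 := by
  unfold AbsTrace
  rw [sum_pow_char]
  exact Finset.sum_congr rfl fun i _ => by rw [← pow_mul, ← pow_mul, mul_comm]

theorem quadratic_ne_zero_of_absTrace {F : Type} [Field F] [Fintype F] [CharP F 2] {h : ℕ}
    (hF : Fintype.card F = 2 ^ h) {c : F} (hc : c ≠ 0) (htr : AbsTrace F h c⁻¹ = 1) {y z : F}
    (hyz : (y, z) ≠ 0) : (y + c * z) * y - z * z ≠ 0 := by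
  intro hQ
  have hz : z ≠ 0 := by
    rintro rfl
    simp_all
  have ht : (y / (c * z)) ^ 2 + y / (c * z) = (c⁻¹) ^ 2 := by
    field_simp
    linear_combination hQ
  have h1 := absTrace_sq_add_self h (y / (c * z))
  rw [ht, absTrace_sq, htr, ← hF, FiniteField.pow_card, CharTwo.add_self_eq_zero] at h1
  simp at h1

/-- The parametrization `(x, y, z) ↦ [[x, 0, 0], [0, y + c z, z], [0, z, y]]` of `Σ₆`. -/
def sigma6Matrix {F : Type} [Field F] (c : F) (p : F × F × F) : Matrix (Fin 3) (Fin 3) F :=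
  !![p.1, 0, 0; 0, p.2.1 + c * p.2.2, p.2.2; 0, p.2.2, p.2.1]

theorem sigma6Matrix_injective {F : Type} [Field F] (c : F) :
    Function.Injective (sigma6Matrix c) := by
  rintro ⟨x, y, z⟩ ⟨x', y', z'⟩ he
  have h0 := congrFun (congrFun he 0) 0
  have h1 := congrFun (congrFun he 2) 2
  have h2 := congrFun (congrFun he 1) 2
  simp [sigma6Matrix] at h0 h1 h2
  simp [h0, h1, h2]

theorem sigma6Matrix_eq_zero {F : Type} [Field F] (c : F) (p : F × F × F) :
    sigma6Matrix c p = 0 ↔ p = 0 := by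
  rw [← (sigma6Matrix_injective c).eq_iff (a := p)]
  have : sigma6Matrix c 0 = 0 := by
    ext i j
    fin_cases i <;> fin_cases j <;> simp [sigma6Matrix]
  rw [this]

theorem sigma6Matrix_diag_eq_zero {F : Type} [Field F] {c : F} (hc : c ≠ 0) (p : F × F × F) :
    (∀ i, sigma6Matrix c p i i = 0) ↔ p = 0 := by
  obtain ⟨x, y, z⟩ := p
  simp only [Fin.forall_fin_succ, sigma6Matrix, Prod.mk_eq_zero]
  constructor
  · intro hd
    have hd' : x = 0 ∧ y + c * z = 0 ∧ y = 0 := by simpa using hd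
    obtain ⟨rfl, h1, rfl⟩ := hd'
    simpa [hc] using h1
  · rintro ⟨rfl, rfl, rfl⟩
    simp

theorem rank_sigma6Matrix {F : Type} [Field F] [DecidableEq F] {c : F}
    (hQ : ∀ y z : F, (y, z) ≠ 0 → (y + c * z) * y - z * z ≠ 0) (p : F × F × F) :
    (sigma6Matrix c p).rank = (if p.1 = 0 then 0 else 1) + (if p.2 = 0 then 0 else 2) := by
  obtain ⟨x, y, z⟩ := p
  by_cases hyz : (y, z) = 0
  · have e : sigma6Matrix c (x, y, z) = diagonal ![x, 0, 0] := by
      obtain ⟨rfl, rfl⟩ := Prod.mk_eq_zero.1 hyz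
      ext i j
      fin_cases i <;> fin_cases j <;> simp [sigma6Matrix]
    rw [e, rank_diagonal, Fintype.card_subtype, Finset.card_filter, Fin.sum_univ_three]
    by_cases hx : x = 0 <;> simp [hyz, hx]
  · have e : sigma6Matrix c (x, y, z) = diagonal ![x, 1, 1] * sigma6Matrix c (1, y, z) := by
      ext i j
      fin_cases i <;> fin_cases j <;> simp [sigma6Matrix]
    have hdet : IsUnit (sigma6Matrix c (1, y, z)).det := by
      rw [isUnit_iff_ne_zero]
      simpa [sigma6Matrix, det_fin_three] using hQ y z hyz
    rw [e, rank_mul_eq_left_of_isUnit_det _ _ hdet, rank_diagonal, Fintype.card_subtype,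
      Finset.card_filter, Fin.sum_univ_three]
    by_cases hx : x = 0 <;> simp [hyz, hx]

theorem card_isPointOf_mul {F : Type} [Field F] [Finite F] {c : F}
    {W : Submodule F (Matrix (Fin 3) (Fin 3) F)}
    (hW : (W : Set (Matrix (Fin 3) (Fin 3) F)) = Set.range (sigma6Matrix c))
    (pred : Matrix (Fin 3) (Fin 3) F → Prop)
    (hpred : ∀ a : F, a ≠ 0 → ∀ M, pred M → pred (a • M))
    {T : Set (F × F × F)} (hT : ∀ p, p ∈ T ↔ p ≠ 0 ∧ pred (sigma6Matrix c p)) :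
    Nat.card {P | IsPointOf F W P pred} * (Nat.card F - 1) = T.ncard := by
  have hS := card_lines_mul_card_sub_one (F := F) (sigma6Matrix c '' T)
    (by
      rintro _ ⟨p, hp, rfl⟩
      rw [Ne, sigma6Matrix_eq_zero]
      exact ((hT p).1 hp).1)
    (by
      rintro a ha _ ⟨p, hp, rfl⟩
      have e : a • sigma6Matrix c p = sigma6Matrix c (a • p) := by
        ext i j
        fin_cases i <;> fin_cases j <;> simp [sigma6Matrix]
        ring
      refine ⟨a • p, (hT _).2 ⟨smul_ne_zero ha ((hT p).1 hp).1, ?_⟩, e.symm⟩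
      rw [← e]
      exact hpred a ha _ ((hT p).1 hp).2)
  rw [Nat.card_coe_set_eq (sigma6Matrix c '' T),
    Set.ncard_image_of_injective _ (sigma6Matrix_injective c)] at hS
  rw [← hS]
  congr 3
  ext P
  have hmem : ∀ M, M ∈ W ↔ ∃ p, sigma6Matrix c p = M := fun M => by
    rw [← SetLike.mem_coe, hW, Set.mem_range]
  constructor
  · rintro ⟨hPW, hP, hp⟩
    refine ⟨hP, fun M hM hM0 => ?_⟩
    obtain ⟨p, rfl⟩ := (hmem M).1 (hPW hM)
    exact ⟨p, (hT p).2 ⟨by rwa [Ne, sigma6Matrix_eq_zero] at hM0, hp _ hM hM0⟩, rfl⟩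
  · rintro ⟨hP, hp⟩
    refine ⟨fun M hM => ?_, hP, fun M hM hM0 => ?_⟩
    · by_cases hM0 : M = 0
      · exact hM0 ▸ W.zero_mem
      · obtain ⟨p, _, rfl⟩ := hp M hM hM0
        exact (hmem _).2 ⟨p, rfl⟩
    · obtain ⟨p, hpT, rfl⟩ := hp M hM hM0
      exact ((hT p).1 hpT).2

/-- The plane `Σ₆` has point-orbit distribution `[1, 0, q+1, q²-1]`. -/
theorem sigma6_point_orbit_distribution (h : ℕ) (hh : 0 < h)
    (F : Type) [Field F] [Fintype F] (hF : Fintype.card F = 2 ^ h)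
    (c : F) (hc : c ≠ 0) (htr : AbsTrace F h c⁻¹ = 1)
    (W : Submodule F (Matrix (Fin 3) (Fin 3) F))
    (hW : (W : Set (Matrix (Fin 3) (Fin 3) F)) =
      {M | ∃ x y z : F, M = !![x, 0, 0; 0, y + c * z, z; 0, z, y]}) :
    Nat.card {P | IsPointOf F W P (fun M => M.rank = 1)} = 1 ∧
    Nat.card {P | IsPointOf F W P (fun M => M.rank = 2 ∧ ∀ i, M i i = 0)} = 0 ∧
    Nat.card {P | IsPointOf F W P (fun M => M.rank = 2 ∧ ∃ i, M i i ≠ 0)} = 2 ^ h + 1 ∧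
    Nat.card {P | IsPointOf F W P (fun M => M.rank = 3)} = (2 ^ h) ^ 2 - 1 := by
  classical
  have h2 : CharP F 2 := by
    have hp : CharP F (ringChar F) := ringChar.charP F
    obtain ⟨n, hn, hcard⟩ := FiniteField.card F (ringChar F)
    have hd : ringChar F ∣ 2 ^ h := by
      rw [← hF, hcard]
      exact dvd_pow_self _ n.ne_zero
    rwa [(Nat.prime_dvd_prime_iff_eq hn Nat.prime_two).1 (hn.dvd_of_dvd_pow hd)] at hp
  have hrank := rank_sigma6Matrix (c := c)
    fun y z hyz => quadratic_ne_zero_of_absTrace hF hc htr hyz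
  have hW' : (W : Set (Matrix (Fin 3) (Fin 3) F)) = Set.range (sigma6Matrix c) := by
    rw [hW]
    ext M
    simp [sigma6Matrix, Prod.exists, eq_comm]
  have hq : 2 ≤ 2 ^ h := Nat.le_self_pow hh.ne' 2
  have hq0 : 0 < 2 ^ h - 1 := by omega
  have hcard : Nat.card F = 2 ^ h := by rw [Nat.card_eq_fintype_card, hF]
  have hcard2 : ({0}ᶜ : Set (F × F)).ncard = (2 ^ h) ^ 2 - 1 := by
    rw [Set.ncard_compl, Set.ncard_singleton, Nat.card_prod, hcard, sq]
  have hcard1 : ({0}ᶜ : Set F).ncard = 2 ^ h - 1 := by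
    rw [Set.ncard_compl, Set.ncard_singleton, hcard]
  have hsq : (2 ^ h) ^ 2 - 1 = (2 ^ h + 1) * (2 ^ h - 1) := by
    simpa using Nat.sq_sub_sq (2 ^ h) 1
  refine ⟨?_, ?_, ?_, ?_⟩
  · have := card_isPointOf_mul hW' (fun M => M.rank = 1)
      (fun a ha M hM => by
        rwa [rank_smul_of_mem_nonZeroDivisors _ (mem_nonZeroDivisors_of_ne_zero ha)])
      (T := ({0}ᶜ : Set F) ×ˢ ({0} : Set (F × F))) (fun p => by
        rw [hrank]
        obtain ⟨x, p⟩ := p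
        by_cases hx : x = 0 <;> by_cases hp : p = 0 <;> simp [hx, hp])
    rw [Set.ncard_prod, hcard1, hcard, Set.ncard_singleton, mul_comm] at this
    exact Nat.eq_of_mul_eq_mul_left hq0 this
  · have := card_isPointOf_mul hW' (fun M => M.rank = 2 ∧ ∀ i, M i i = 0)
      (fun a ha M hM => by
        simpa [rank_smul_of_mem_nonZeroDivisors _ (mem_nonZeroDivisors_of_ne_zero ha), ha] using hM)
      (T := ∅) (fun p => by
        rw [sigma6Matrix_diag_eq_zero hc]
        simp only [Set.mem_empty_iff_false, false_iff]
        tauto)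
    rw [Set.ncard_empty, hcard] at this
    exact (Nat.mul_eq_zero.1 this).resolve_right hq0.ne'
  · have := card_isPointOf_mul hW' (fun M => M.rank = 2 ∧ ∃ i, M i i ≠ 0)
      (fun a ha M hM => by
        simpa [rank_smul_of_mem_nonZeroDivisors _ (mem_nonZeroDivisors_of_ne_zero ha), ha] using hM)
      (T := ({0} : Set F) ×ˢ ({0}ᶜ : Set (F × F))) (fun p => by
        rw [← not_forall, sigma6Matrix_diag_eq_zero hc, hrank]
        obtain ⟨x, p⟩ := p
        by_cases hx : x = 0 <;> by_cases hp : p = 0 <;> simp [hx, hp])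
    rw [Set.ncard_prod, hcard2, hcard, Set.ncard_singleton, one_mul, hsq] at this
    exact Nat.eq_of_mul_eq_mul_right hq0 this
  · have := card_isPointOf_mul hW' (fun M => M.rank = 3)
      (fun a ha M hM => by
        rwa [rank_smul_of_mem_nonZeroDivisors _ (mem_nonZeroDivisors_of_ne_zero ha)])
      (T := ({0}ᶜ : Set F) ×ˢ ({0}ᶜ : Set (F × F))) (fun p => by
        rw [hrank]
        obtain ⟨x, p⟩ := p
        by_cases hx : x = 0 <;> by_cases hp : p = 0 <;> simp [hx, hp])
    rw [Set.ncard_prod, hcard2, hcard1, hcard, mul_comm] at this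
    exact Nat.eq_of_mul_eq_mul_left hq0 this
end
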